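/- arXiv:2006.06693 — 10 statements merged into one kernel-verified Lean document; each statement's English description precedes it below -/
import Mathlib

section
/- Let N ≥ 2, and let p, q ≥ 0 with p + q ≤ 1. Define the GHZ-type distribution P on {0,1}^N by P(0,…,0) = p, P(1,…,1) = q, and P(x) = (1−p−q)/(2^N − 2) for all other strings x. Then the N×N matrix C with entries C_{αβ} = P(x_α=0, x_β=0) − P(x_α=0)P(x_β=0) for α ≠ β and C_{αα} = P(x_α=0)(1 − P(x_α=0)) equals C = Δ·I_N + χ·J_N, where Δ = 2^{N−2}(1−p−q)/(2^N − 2) and χ = (1 − (p−q)²)/4 − Δ. -/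
open Matrix BigOperators

theorem ghz_card (N : ℕ) (S : Finset (Fin N)) :
    (Finset.univ.filter (fun x : Fin N → Fin 2 => ∀ n ∈ S, x n = 0)).card = 2 ^ (N - S.card) := by
  have h : Finset.univ.filter (fun x : Fin N → Fin 2 => ∀ n ∈ S, x n = 0)
      = Fintype.piFinset (fun n => if n ∈ S then ({0} : Finset (Fin 2)) else Finset.univ) := by
    ext x
    simp only [Finset.mem_filter, Finset.mem_univ, true_and, Fintype.mem_piFinset]
    refine forall_congr' fun n => ?_
    by_cases hn : n ∈ S <;> simp [hn]
  rw [h, Fintype.card_piFinset]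
  have h2 : ∀ n, (if n ∈ S then ({0} : Finset (Fin 2)) else Finset.univ).card
      = if n ∈ S then 1 else 2 := by
    intro n; split_ifs <;> simp
  simp only [h2]
  rw [Finset.prod_ite]
  simp only [Finset.prod_const, one_pow, one_mul]
  congr 1
  have : Finset.univ.filter (fun n => n ∉ S) = Sᶜ := by ext; simp
  rw [this, Finset.card_compl, Fintype.card_fin]

theorem ghz_sum (N : ℕ) (p q r : ℝ) (P : (Fin N → Fin 2) → ℝ)
    (hP : ∀ x, P x = if ∀ n, x n = 0 then p else if ∀ n, x n = 1 then q else r)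
    (S : Finset (Fin N)) (hS : S.Nonempty) :
    ∑ x ∈ Finset.univ.filter (fun x : Fin N → Fin 2 => ∀ n ∈ S, x n = 0), P x
      = p + (2 ^ (N - S.card) - 1) * r := by
  obtain ⟨a, ha⟩ := hS
  have h : ∀ x ∈ Finset.univ.filter (fun x : Fin N → Fin 2 => ∀ n ∈ S, x n = 0),
      P x = r + if x = 0 then p - r else 0 := by
    intro x hx
    have hx' := (Finset.mem_filter.1 hx).2 a ha
    have h1 : ¬ ∀ n, x n = 1 := fun h => by
      have := h a
      rw [hx'] at this
      exact absurd this (by decide)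
    have h0 : (∀ n, x n = 0) ↔ x = 0 := by
      rw [funext_iff]; rfl
    rw [hP, if_neg h1]
    by_cases hz : x = 0
    · rw [if_pos (h0.2 hz), if_pos hz]; ring
    · rw [if_neg (fun h => hz (h0.1 h)), if_neg hz]; ring
  rw [Finset.sum_congr rfl h, Finset.sum_add_distrib, Finset.sum_const, ghz_card,
    Finset.sum_ite_eq', if_pos (by simp)]
  simp only [nsmul_eq_mul]
  push_cast
  ring

/-- For the GHZ-type distribution on `{0,1}^N` (`P(0…0) = p`, `P(1…1) = q`,
uniform `(1-p-q)/(2^N-2)` otherwise), the covariance matrix `C` with entries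
`C αβ = P(x_α=0, x_β=0) - P(x_α=0)P(x_β=0)` (α ≠ β) and `C αα = P(x_α=0)(1 - P(x_α=0))`
equals `Δ·I + χ·J` with `Δ = 2^(N-2)(1-p-q)/(2^N-2)` and `χ = (1-(p-q)²)/4 - Δ`. -/
theorem ghz_covariance_matrix
    (N : ℕ) (hN : 2 ≤ N)
    (p q : ℝ) (hp : 0 ≤ p) (hq : 0 ≤ q) (hpq : p + q ≤ 1)
    (P : (Fin N → Fin 2) → ℝ)
    (hP : ∀ x, P x =
      if ∀ n, x n = 0 then p
      else if ∀ n, x n = 1 then q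
      else (1 - p - q) / (2 ^ N - 2))
    (marg : Fin N → Fin 2 → ℝ)
    (hmarg : ∀ α i, marg α i = ∑ x ∈ Finset.univ.filter (fun x => x α = i), P x)
    (marg2 : Fin N → Fin N → Fin 2 → Fin 2 → ℝ)
    (hmarg2 : ∀ α β i j,
      marg2 α β i j = ∑ x ∈ Finset.univ.filter (fun x => x α = i ∧ x β = j), P x)
    (C : Matrix (Fin N) (Fin N) ℝ)
    (hC : ∀ α β, C α β =
      if α = β then marg α 0 * (1 - marg α 0)
      else marg2 α β 0 0 - marg α 0 * marg β 0)
    (Δ χ : ℝ)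
    (hΔ : Δ = 2 ^ (N - 2) * (1 - p - q) / (2 ^ N - 2))
    (hχ : χ = (1 - (p - q) ^ 2) / 4 - Δ) :
    C = Δ • (1 : Matrix (Fin N) (Fin N) ℝ) + χ • Matrix.of (fun _ _ => (1 : ℝ)) := by
  obtain ⟨k, rfl⟩ := Nat.exists_eq_add_of_le' hN
  have hk : (1 : ℝ) ≤ 2 ^ k := one_le_pow₀ (by norm_num)
  have hD : (2 : ℝ) ^ (k + 2) - 2 ≠ 0 := by
    rw [pow_add]; intro h; linarith
  have h1 : ∀ α, marg α 0 = (1 + p - q) / 2 := by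
    intro α
    have := ghz_sum (k + 2) p q _ P hP {α} (by simp)
    simp only [Finset.mem_singleton, forall_eq, Finset.card_singleton] at this
    rw [hmarg, this, show k + 2 - 1 = k + 1 by omega]
    field_simp
    ring
  ext α β
  rw [hC]
  simp only [Matrix.add_apply, Matrix.smul_apply, Matrix.of_apply, smul_eq_mul, mul_one,
    Matrix.one_apply]
  by_cases hab : α = β
  · rw [if_pos hab, if_pos hab, h1, hχ]
    ring
  · rw [if_neg hab, if_neg hab, h1, h1, hmarg2, hχ, hΔ]
    have := ghz_sum (k + 2) p q _ P hP {α, β} (by simp)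
    simp only [Finset.mem_insert, Finset.mem_singleton, forall_eq_or_imp, forall_eq,
      Finset.card_pair hab] at this
    rw [this, Nat.add_sub_cancel]
    field_simp
    ring
end

section
/- Let X ∈ ℂ^{N×N} be a positive semidefinite matrix with coherence number at most k, i.e., X = Σ_j v_j v_j† for finitely many vectors v_j ∈ ℂ^N each having at most k nonzero entries. Then tr[J_N X] ≤ k · tr[X], where J_N is the N×N all-ones matrix. -/
open Matrix BigOperators
open scoped ComplexOrder

/-- A positive semidefinite matrix `X` has coherence number at most `k` if it can be written
as a finite sum `∑ j, v_j v_j†` where each vector `v_j` has at most `k` nonzero entries. -/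
def CohNumLE {N : ℕ} (k : ℕ) (X : Matrix (Fin N) (Fin N) ℂ) : Prop :=
  ∃ (m : ℕ) (v : Fin m → Fin N → ℂ),
    X = ∑ j, Matrix.vecMulVec (v j) (star (v j)) ∧
    ∀ j, (Finset.univ.filter (fun i => v j i ≠ 0)).card ≤ k

/-- Cauchy-Schwarz on the support of `v`. -/
theorem normSq_sum_le_card {N : ℕ} (k : ℕ) (v : Fin N → ℂ)
    (h : (Finset.univ.filter (fun i => v i ≠ 0)).card ≤ k) :
    ‖∑ i, v i‖ ^ 2 ≤ (k : ℝ) * ∑ i, ‖v i‖ ^ 2 := by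
  set S := Finset.univ.filter (fun i => v i ≠ 0) with hS
  have h1 : ∑ i, v i = ∑ i ∈ S, v i := by
    rw [hS, Finset.sum_filter_ne_zero]
  calc ‖∑ i, v i‖ ^ 2 ≤ (∑ i ∈ S, ‖v i‖) ^ 2 := by
        rw [h1]
        gcongr
        exact norm_sum_le _ _
    _ ≤ (S.card : ℝ) * ∑ i ∈ S, ‖v i‖ ^ 2 := sq_sum_le_card_mul_sum_sq
    _ ≤ (k : ℝ) * ∑ i, ‖v i‖ ^ 2 := by
        gcongr
        exact Finset.subset_univ _

/-- If `X` is positive semidefinite with coherence number at most `k`,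
then `tr[J X] ≤ k · tr[X]`, where `J` is the all-ones matrix.  (I.e. `W_k = I - J/k` is a
`(k+1)`-level coherence witness.) -/
theorem allones_trace_coherence_witness
    (N k : ℕ) (X : Matrix (Fin N) (Fin N) ℂ)
    (hX : CohNumLE k X) :
    Matrix.trace (Matrix.of (fun _ _ => (1 : ℂ)) * X) ≤ (k : ℂ) * Matrix.trace X := by
  obtain ⟨m, v, rfl, hv⟩ := hX
  rw [Finset.mul_sum, Matrix.trace_sum, Matrix.trace_sum, Finset.mul_sum]
  refine Finset.sum_le_sum fun j _ => ?_
  have key := normSq_sum_le_card k (v j) (hv j)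
  have e1 : Matrix.trace (Matrix.of (fun _ _ => (1 : ℂ)) *
      Matrix.vecMulVec (v j) (star (v j))) = ((‖∑ i, v j i‖ ^ 2 : ℝ) : ℂ) := by
    push_cast
    rw [← Complex.mul_conj']
    simp only [Matrix.trace, Matrix.diag, Matrix.mul_apply, Matrix.of_apply, one_mul,
      Matrix.vecMulVec_apply, Pi.star_apply, map_sum, Finset.sum_mul_sum]
    rw [Finset.sum_comm]
    rfl
  have e2 : Matrix.trace (Matrix.vecMulVec (v j) (star (v j)))
      = ((∑ i, ‖v j i‖ ^ 2 : ℝ) : ℂ) := by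
    push_cast
    simp only [← Complex.mul_conj']
    rfl
  rw [e1, e2]
  exact_mod_cast key
end

section
/- Let N ≥ 2, 1 ≤ k ≤ N, and 0 ≤ μ ≤ 1. The matrix ρ(μ) = μ·J_N/N + (1−μ)·I_N/N (which is positive semidefinite with trace 1) has coherence number at most k if and only if μ(N−1) ≤ k−1. -/
open Matrix BigOperators

lemma cohNumLE_of_fintype {N : ℕ} (k : ℕ) (X : Matrix (Fin N) (Fin N) ℂ) {ι : Type} [Fintype ι]
    (v : ι → Fin N → ℂ) (hX : X = ∑ j, Matrix.vecMulVec (v j) (star (v j)))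
    (hv : ∀ j, (Finset.univ.filter (fun i => v j i ≠ 0)).card ≤ k) : CohNumLE k X := by
  refine ⟨Fintype.card ι, fun j => v ((Fintype.equivFin ι).symm j), ?_, fun j => hv _⟩
  rw [hX]
  exact (Equiv.sum_comp (Fintype.equivFin ι).symm
    (fun j => Matrix.vecMulVec (v j) (star (v j)))).symm

lemma sparse_bound {N : ℕ} (k : ℕ) (v : Fin N → ℂ)
    (hv : (Finset.univ.filter (fun i => v i ≠ 0)).card ≤ k) :
    ‖∑ i, v i‖ ^ 2 ≤ k * ∑ i, ‖v i‖ ^ 2 := by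
  classical
  have h1 : ∑ i, v i = ∑ i ∈ Finset.univ.filter (fun i => v i ≠ 0), v i :=
    (Finset.sum_filter_ne_zero _).symm
  have h2 : ‖∑ i, v i‖ ≤ ∑ i ∈ Finset.univ.filter (fun i => v i ≠ 0), ‖v i‖ := by
    rw [h1]; exact norm_sum_le _ _
  have h3 : ∑ i ∈ Finset.univ.filter (fun i => v i ≠ 0), ‖v i‖ ^ 2 ≤ ∑ i, ‖v i‖ ^ 2 :=
    Finset.sum_le_sum_of_subset_of_nonneg (Finset.subset_univ _) (fun _ _ _ => by positivity)
  calc ‖∑ i, v i‖ ^ 2 ≤ (∑ i ∈ Finset.univ.filter (fun i => v i ≠ 0), ‖v i‖) ^ 2 := by gcongr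
    _ ≤ ((Finset.univ.filter (fun i => v i ≠ 0)).card : ℝ) *
          ∑ i ∈ Finset.univ.filter (fun i => v i ≠ 0), ‖v i‖ ^ 2 := sq_sum_le_card_mul_sum_sq
    _ ≤ k * ∑ i, ‖v i‖ ^ 2 := by gcongr

/-- number of `k`-subsets containing both `p` and `q`. -/
def cnt (N k : ℕ) (p q : Fin N) : ℕ :=
  ((Finset.powersetCard k Finset.univ).filter (fun S : Finset (Fin N) => p ∈ S ∧ q ∈ S)).card

lemma cnt_perm (N k : ℕ) (p q : Fin N) (σ : Equiv.Perm (Fin N)) :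
    cnt N k (σ p) (σ q) = cnt N k p q := by
  unfold cnt
  symm
  refine Finset.card_bij (fun S _ => S.map σ.toEmbedding) ?_ ?_ ?_
  · intro S hS
    simp only [Finset.mem_filter, Finset.mem_powersetCard_univ] at hS ⊢
    simpa using hS
  · intro S _ T _ h
    exact Finset.map_injective _ h
  · intro T hT
    refine ⟨T.map σ.symm.toEmbedding, ?_, ?_⟩
    · simp only [Finset.mem_filter, Finset.mem_powersetCard_univ] at hT ⊢
      simpa using hT
    · ext x; simp

lemma cnt_diag (N k : ℕ) (p q : Fin N) : cnt N k p p = cnt N k q q := by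
  have := cnt_perm N k q q (Equiv.swap q p)
  simpa using this

lemma cnt_off (N k : ℕ) (p q r : Fin N) (hq : q ≠ p) (hr : r ≠ p) :
    cnt N k p q = cnt N k p r := by
  have := cnt_perm N k p r (Equiv.swap r q)
  rwa [Equiv.swap_apply_of_ne_of_ne hr.symm hq.symm, Equiv.swap_apply_left] at this

lemma cnt_row (N k : ℕ) (p : Fin N) : ∑ q, cnt N k p q = k * cnt N k p p := by
  unfold cnt
  simp only [Finset.card_filter]
  rw [Finset.sum_comm, Finset.mul_sum]
  refine Finset.sum_congr rfl fun S hS => ?_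
  rw [Finset.mem_powersetCard_univ] at hS
  by_cases h : p ∈ S
  · simp [h, hS]
  · simp [h]

lemma cnt_pos (N k : ℕ) (hk1 : 1 ≤ k) (hkN : k ≤ N) (p : Fin N) : 0 < cnt N k p p := by
  obtain ⟨S, hS, -, hc⟩ := Finset.exists_subsuperset_card_eq (s := {p}) (t := Finset.univ) (n := k)
    (Finset.subset_univ _) (by simpa using hk1) (by simpa using hkN)
  refine Finset.card_pos.2 ⟨S, ?_⟩
  simp only [Finset.mem_filter, Finset.mem_powersetCard_univ]
  exact ⟨hc, by simpa using hS⟩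

lemma cnt_rel (N k : ℕ) (p q : Fin N) (hq : q ≠ p) :
    ((N : ℝ) - 1) * cnt N k p q = ((k : ℝ) - 1) * cnt N k p p := by
  have h := cnt_row N k p
  rw [← Finset.add_sum_erase _ _ (Finset.mem_univ p)] at h
  rw [Finset.sum_congr rfl (g := fun _ => cnt N k p q)
    (fun r hr => cnt_off N k p r q (Finset.ne_of_mem_erase hr) hq)] at h
  rw [Finset.sum_const, Finset.card_erase_of_mem (Finset.mem_univ p), Finset.card_univ,
    Fintype.card_fin, smul_eq_mul] at h
  have hN : 1 ≤ N := by have := p.2; omega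
  have h' : (cnt N k p p : ℝ) + ((N : ℝ) - 1) * cnt N k p q = k * cnt N k p p := by
    rw [← Nat.cast_one, ← Nat.cast_sub hN]; exact_mod_cast h
  linarith

/-- The isotropic state `ρ(μ) = μ·J/N + (1-μ)·I/N` has coherence number
at most `k` if and only if `μ(N-1) ≤ k-1`. -/
theorem isotropic_coherence_number
    (N k : ℕ) (hN : 2 ≤ N) (hk1 : 1 ≤ k) (hkN : k ≤ N)
    (μ : ℝ) (hμ0 : 0 ≤ μ) (hμ1 : μ ≤ 1)
    (ρ : Matrix (Fin N) (Fin N) ℂ)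
    (hρ : ρ = ((μ / N : ℝ) : ℂ) • Matrix.of (fun _ _ => (1 : ℂ)) +
      (((1 - μ) / N : ℝ) : ℂ) • (1 : Matrix (Fin N) (Fin N) ℂ)) :
    CohNumLE k ρ ↔ μ * (N - 1) ≤ k - 1 := by
  classical
  have hN2 : (2 : ℝ) ≤ N := by exact_mod_cast hN
  have hNpos : (0 : ℝ) < N := by linarith
  have hkr : (1 : ℝ) ≤ k := by exact_mod_cast hk1
  have hent : ∀ p q, ρ p q = ((μ / N + if p = q then (1 - μ) / N else 0 : ℝ) : ℂ) := by
    intro p q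
    rw [hρ]
    by_cases h : p = q <;> simp [h]
  constructor
  · rintro ⟨m, v, hX, hv⟩
    have hE : ∀ p q, ρ p q = ∑ j, v j p * star (v j q) := by
      intro p q
      rw [hX, Matrix.sum_apply]
      rfl
    have htr : (1 : ℝ) = ∑ j, ∑ i, ‖v j i‖ ^ 2 := by
      have h1 : ∑ i, ρ i i = ((∑ j, ∑ i, ‖v j i‖ ^ 2 : ℝ) : ℂ) := by
        simp only [hE]
        rw [Finset.sum_comm]
        push_cast
        refine Finset.sum_congr rfl fun j _ => Finset.sum_congr rfl fun i _ => ?_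
        exact Complex.mul_conj' _
      have h2 : ∑ i, ρ i i = ((1 : ℝ) : ℂ) := by
        simp only [hent, if_true]
        rw [Finset.sum_const, Finset.card_univ, Fintype.card_fin, nsmul_eq_mul]
        have : (N : ℝ) * (μ / N + (1 - μ) / N) = 1 := by field_simp; ring
        exact_mod_cast this
      exact_mod_cast h2.symm.trans h1
    have hsum : μ * N + (1 - μ) = ∑ j, ‖∑ i, v j i‖ ^ 2 := by
      have h1 : ∑ p, ∑ q, ρ p q = ((∑ j, ‖∑ i, v j i‖ ^ 2 : ℝ) : ℂ) := by
        push_cast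
        simp only [← Complex.mul_conj', map_sum, Finset.sum_mul_sum, hE]
        rw [Finset.sum_comm (s := (Finset.univ : Finset (Fin m)))]
        exact Finset.sum_congr rfl fun p _ => Finset.sum_comm
      have h2 : ∑ p, ∑ q, ρ p q = ((μ * N + (1 - μ) : ℝ) : ℂ) := by
        simp only [hent, ← Complex.ofReal_sum]
        congr 1
        simp only [Finset.sum_add_distrib, Finset.sum_ite_eq, Finset.mem_univ, if_true,
          Finset.sum_const, Finset.card_univ, Fintype.card_fin, nsmul_eq_mul]
        field_simp
      exact_mod_cast h2.symm.trans h1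
    have : ∑ j, ‖∑ i, v j i‖ ^ 2 ≤ ∑ j, (k : ℝ) * ∑ i, ‖v j i‖ ^ 2 :=
      Finset.sum_le_sum fun j _ => sparse_bound k (v j) (hv j)
    rw [← Finset.mul_sum, ← htr, ← hsum] at this
    linarith
  · intro hle
    obtain ⟨t, ht0, ht1, ht⟩ : ∃ t : ℝ, 0 ≤ t ∧ t ≤ 1 ∧ t * ((k : ℝ) - 1) = μ * (N - 1) := by
      have h0 : 0 ≤ μ * ((N : ℝ) - 1) := mul_nonneg hμ0 (by linarith)
      rcases hkr.eq_or_lt with h | h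
      · exact ⟨0, le_rfl, zero_le_one, by rw [← h] at hle; linarith⟩
      · have hk' : (0 : ℝ) < k - 1 := by linarith
        exact ⟨μ * (N - 1) / (k - 1), by positivity, (div_le_one hk').2 hle, by field_simp⟩
    let p0 : Fin N := ⟨0, by omega⟩
    have hc := cnt_pos N k hk1 hkN p0
    set c : ℝ := (cnt N k p0 p0 : ℝ) with hcdef
    have hc0 : 0 < c := Nat.cast_pos.2 hc
    have hcd : ∀ p, (cnt N k p p : ℝ) = c := fun p => by rw [hcdef, cnt_diag N k p p0]
    set a : ℝ := t / (N * c) with ha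
    set b : ℝ := (1 - t) / N with hb
    have ha0 : 0 ≤ a := by positivity
    have hb0 : 0 ≤ b := div_nonneg (by linarith) hNpos.le
    refine cohNumLE_of_fintype (ι := Finset (Fin N) ⊕ Fin N) k ρ
      (Sum.elim (fun S i => if S.card = k ∧ i ∈ S then ((√a : ℝ) : ℂ) else 0)
        (fun j i => if i = j then ((√b : ℝ) : ℂ) else 0)) ?_ ?_
    · ext p q
      rw [Matrix.sum_apply, Fintype.sum_sum_type]
      simp only [Sum.elim_inl, Sum.elim_inr, Matrix.vecMulVec_apply, Pi.star_apply]
      have e1 : ∑ S : Finset (Fin N), (if S.card = k ∧ p ∈ S then ((√a : ℝ) : ℂ) else 0) *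
          star (if S.card = k ∧ q ∈ S then ((√a : ℝ) : ℂ) else 0) =
          ((a * cnt N k p q : ℝ) : ℂ) := by
        have : ∀ S : Finset (Fin N), (if S.card = k ∧ p ∈ S then ((√a : ℝ) : ℂ) else 0) *
          star (if S.card = k ∧ q ∈ S then ((√a : ℝ) : ℂ) else 0) =
          if (S.card = k ∧ p ∈ S ∧ q ∈ S) then (a : ℂ) else 0 := by
          intro S
          have : ((√a : ℝ) : ℂ) * ((√a : ℝ) : ℂ) = (a : ℂ) := by
            rw [← Complex.ofReal_mul, Real.mul_self_sqrt ha0]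
          by_cases h1 : S.card = k <;> by_cases h2 : p ∈ S <;> by_cases h3 : q ∈ S <;>
            simp [h1, h2, h3, this]
        simp only [this]
        rw [← Finset.sum_filter, Finset.sum_const, nsmul_eq_mul, mul_comm]
        push_cast
        congr 2
        unfold cnt
        norm_cast
        congr 1
        ext S
        simp
      have e2 : ∑ j : Fin N, (if p = j then ((√b : ℝ) : ℂ) else 0) *
          star (if q = j then ((√b : ℝ) : ℂ) else 0) = ((if p = q then b else 0 : ℝ) : ℂ) := by
        have : ((√b : ℝ) : ℂ) * ((√b : ℝ) : ℂ) = (b : ℂ) := by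
          rw [← Complex.ofReal_mul, Real.mul_self_sqrt hb0]
        by_cases h : p = q
        · simp [h, this]
        · simp [h, Ne.symm h]
      rw [e1, e2, hent, ← Complex.ofReal_add]
      congr 1
      by_cases h : p = q
      · subst h
        rw [if_pos rfl, if_pos rfl, hcd, ha, hb]
        field_simp
        ring
      · rw [if_neg h, if_neg h, add_zero, add_zero]
        have h1 := cnt_rel N k p q (Ne.symm h)
        rw [hcd] at h1
        have hN1 : (0 : ℝ) < N - 1 := by linarith
        have : (cnt N k p q : ℝ) = (k - 1) * c / (N - 1) := by
          rw [eq_div_iff hN1.ne']; linarith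
        rw [this, ha]
        field_simp
        linarith
    · rintro (S | j)
      · simp only [Sum.elim_inl]
        by_cases h : S.card = k
        · rw [← h]
          refine Finset.card_le_card fun i hi => ?_
          by_contra hn
          simp [hn] at hi
        · simp [h]
      · simp only [Sum.elim_inr]
        refine le_trans ?_ hk1
        rw [← Finset.card_singleton j]
        refine Finset.card_le_card fun i hi => ?_
        by_contra hn
        rw [Finset.mem_singleton] at hn
        simp [hn] at hi
end

section
/- Fix a partition of {1,…,n} into N nonempty blocks B_1,…,B_N, and let Γ ∈ ℂ^{n×n} be a Hermitian positive semidefinite matrix with block coherence number at most 2, i.e., Γ = Σ_j v_j v_j† where each v_j has its nonzero entries contained in the union of at most 2 blocks. Let s: {1,…,N}×{1,…,N} → {+1,−1} be any symmetric sign assignment (s_{αβ} = s_{βα}) with s_{αα} = +1 for all α. Then the matrix Γ' defined blockwise by Γ'_{αβ} = s_{αβ} Γ_{αβ} is also positive semidefinite. -/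
open Matrix BigOperators
open scoped ComplexOrder

/-- With respect to the partition of `Fin n` into the fibers of a surjective block-labelling
map `blk : Fin n → Fin N`, a matrix `X` has block coherence number at most `k` if it can be
written as a finite sum `∑ j, v_j v_j†` where each `v_j` is supported on the union of at
most `k` blocks. -/
def BlockCohLE {n N : ℕ} (blk : Fin n → Fin N) (k : ℕ)
    (X : Matrix (Fin n) (Fin n) ℂ) : Prop :=
  ∃ (m : ℕ) (v : Fin m → Fin n → ℂ),
    X = ∑ j, Matrix.vecMulVec (v j) (star (v j)) ∧
    ∀ j, ∃ S : Finset (Fin N), S.card ≤ k ∧ ∀ i, v j i ≠ 0 → blk i ∈ S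

/-- If `Γ` is positive semidefinite with block coherence number at most 2,
then flipping the signs of off-diagonal blocks by any symmetric sign assignment `s`
(with `s α α = 1`) leaves the matrix positive semidefinite. -/
theorem sign_flip_block_coherence_two
    (n N : ℕ) (blk : Fin n → Fin N) (hblk : Function.Surjective blk)
    (Γ : Matrix (Fin n) (Fin n) ℂ) (hΓ : BlockCohLE blk 2 Γ)
    (s : Fin N → Fin N → ℝ)
    (hs : ∀ α β, s α β = 1 ∨ s α β = -1)
    (hsym : ∀ α β, s α β = s β α)
    (hdiag : ∀ α, s α α = 1) :
    Matrix.PosSemidef (Matrix.of fun i j => (s (blk i) (blk j) : ℂ) * Γ i j) := by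
  obtain ⟨m, v, hX, hv⟩ := hΓ
  have key : ∀ j, ∃ t : Fin N → ℝ, ∀ i k, v j i ≠ 0 → v j k ≠ 0 →
      s (blk i) (blk k) = t (blk i) * t (blk k) := by
    intro j
    obtain ⟨S, hS, hsup⟩ := hv j
    rcases S.eq_empty_or_nonempty with h0 | ⟨a, ha⟩
    · refine ⟨fun _ => 1, fun i k hi _ => ?_⟩
      have := hsup i hi
      simp [h0] at this
    · refine ⟨s a, fun i k hi hk => ?_⟩
      have h1 := hsup i hi
      have h2 := hsup k hk
      by_cases e1 : blk i = a
      · rw [e1, hdiag, one_mul]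
      by_cases e2 : blk k = a
      · rw [e2, hdiag, mul_one, hsym]
      by_cases e3 : blk i = blk k
      · rw [e3, hdiag]
        rcases hs a (blk k) with h | h <;> rw [h] <;> norm_num
      · exfalso
        have hc : 2 < S.card := Finset.two_lt_card.2
          ⟨blk i, h1, blk k, h2, a, ha, e3, e1, e2⟩
        omega
  choose t ht using key
  have heq : (Matrix.of fun i k => (s (blk i) (blk k) : ℂ) * Γ i k) =
      ∑ j, Matrix.vecMulVec (fun i => (t j (blk i) : ℂ) * v j i)
        (star (fun i => (t j (blk i) : ℂ) * v j i)) := by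
    ext i k
    rw [hX]
    simp only [Matrix.of_apply, Matrix.sum_apply, Matrix.vecMulVec_apply, Pi.star_apply,
      Finset.mul_sum]
    refine Finset.sum_congr rfl fun j _ => ?_
    by_cases hi : v j i = 0
    · simp [hi]
    by_cases hk : v j k = 0
    · simp [hk]
    rw [ht j i k hi hk]
    simp
    ring
  rw [heq]
  exact Matrix.posSemidef_sum _ fun j _ => Matrix.posSemidef_vecMulVec_self_star _
end

section
/- Fix a partition of {1,…,n} into N nonempty blocks B_1,…,B_N, and let X ∈ ℂ^{n×n} be Hermitian positive semidefinite with blocks X_{αβ}. Suppose X is block diagonally dominant: for every α, the smallest eigenvalue of the diagonal block X_{αα} is at least Σ_{β≠α} ‖X_{αβ}‖, where ‖·‖ denotes the largest singular value (operator norm). Then X has block coherence number at most 2, i.e., X = Σ_j v_j v_j† for finitely many vectors v_j each supported on the union of at most 2 blocks. -/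
open Matrix BigOperators
open scoped ComplexOrder

/-- The operator norm (largest singular value) of a complex matrix. -/
noncomputable def opNorm {ι κ : Type*} [Fintype ι] [Fintype κ] [DecidableEq κ]
    (A : Matrix ι κ ℂ) : ℝ :=
  ‖LinearMap.toContinuousLinearMap (Matrix.toEuclideanLin A)‖

lemma blockCoh_zero {n N : ℕ} (blk : Fin n → Fin N) (k : ℕ) : BlockCohLE blk k 0 :=
  ⟨0, fun _ => 0, by simp, fun j => j.elim0⟩

lemma blockCoh_add {n N : ℕ} (blk : Fin n → Fin N) (k : ℕ) {A B : Matrix (Fin n) (Fin n) ℂ}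
    (hA : BlockCohLE blk k A) (hB : BlockCohLE blk k B) : BlockCohLE blk k (A + B) := by
  obtain ⟨a, v, hv, hv'⟩ := hA
  obtain ⟨b, w, hw, hw'⟩ := hB
  refine ⟨a + b, Fin.append v w, ?_, ?_⟩
  · rw [Fin.sum_univ_add, hv, hw]
    simp
  · intro j
    refine Fin.addCases (fun j => ?_) (fun j => ?_) j
    · simpa using hv' j
    · simpa using hw' j

lemma blockCoh_sum {n N : ℕ} (blk : Fin n → Fin N) (k : ℕ) {ι : Type*} (s : Finset ι)
    (A : ι → Matrix (Fin n) (Fin n) ℂ) (hA : ∀ i ∈ s, BlockCohLE blk k (A i)) :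
    BlockCohLE blk k (∑ i ∈ s, A i) :=
  Finset.sum_induction A (BlockCohLE blk k) (fun _ _ => blockCoh_add blk k)
    (blockCoh_zero blk k) hA

lemma blockCoh_of_posSemidef {n N : ℕ} (blk : Fin n → Fin N) (k : ℕ)
    {A : Matrix (Fin n) (Fin n) ℂ} (hA : A.PosSemidef) (S : Finset (Fin N)) (hS : S.card ≤ k)
    (h0 : ∀ i, blk i ∉ S → A i i = 0) : BlockCohLE blk k A := by
  obtain ⟨m, v, hv⟩ := Matrix.posSemidef_iff_eq_sum_vecMulVec.mp hA
  refine ⟨m, v, hv, fun j => ⟨S, hS, fun i hi => ?_⟩⟩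
  by_contra hc
  have h := h0 i hc
  rw [hv, Matrix.sum_apply] at h
  simp only [vecMulVec_apply, Pi.star_apply, RCLike.star_def, Complex.mul_conj] at h
  norm_cast at h
  rw [Finset.sum_eq_zero_iff_of_nonneg (fun _ _ => Complex.normSq_nonneg _)] at h
  exact hi (Complex.normSq_eq_zero.mp (h j (Finset.mem_univ _)))

lemma sub_smul_one_posSemidef {ι : Type*} [Fintype ι] [DecidableEq ι] {A : Matrix ι ι ℂ}
    (hA : A.IsHermitian) (c : ℝ) (hc : ∀ i, c ≤ hA.eigenvalues i) :
    (A - (c : ℂ) • (1 : Matrix ι ι ℂ)).PosSemidef := by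
  have h1 : A - (c : ℂ) • (1 : Matrix ι ι ℂ) =
      (hA.eigenvectorUnitary : Matrix ι ι ℂ) *
        diagonal (fun i => ((hA.eigenvalues i - c : ℝ) : ℂ)) *
        (hA.eigenvectorUnitary : Matrix ι ι ℂ)ᴴ := by
    have h2 : diagonal (fun i => ((hA.eigenvalues i - c : ℝ) : ℂ)) =
        diagonal (RCLike.ofReal ∘ hA.eigenvalues) - (c : ℂ) • (1 : Matrix ι ι ℂ) := by
      ext i j
      by_cases h : i = j
      · subst h; simp
      · simp [h]
    conv_lhs => rw [hA.spectral_theorem, Unitary.conjStarAlgAut_apply]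
    rw [h2, mul_sub, sub_mul]
    congr 1
    have : (hA.eigenvectorUnitary : Matrix ι ι ℂ) * (hA.eigenvectorUnitary : Matrix ι ι ℂ)ᴴ = 1 :=
      Unitary.coe_mul_star_self hA.eigenvectorUnitary
    simp [this]
  rw [h1]
  refine PosSemidef.mul_mul_conjTranspose_same (PosSemidef.diagonal fun i => ?_) _
  simpa using hc i

lemma opNorm_conjT {ι κ : Type*} [Fintype ι] [Fintype κ] [DecidableEq κ] [DecidableEq ι]
    (A : Matrix ι κ ℂ) : opNorm Aᴴ = opNorm A :=
  Matrix.l2_opNorm_conjTranspose A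

lemma opNorm_nonneg' {ι κ : Type*} [Fintype ι] [Fintype κ] [DecidableEq κ]
    (A : Matrix ι κ ℂ) : 0 ≤ opNorm A := norm_nonneg _

lemma opNorm_bilin {ι κ : Type*} [Fintype ι] [Fintype κ] [DecidableEq κ]
    (A : Matrix ι κ ℂ) (x : ι → ℂ) (y : κ → ℂ) :
    2 * ‖star x ⬝ᵥ (A *ᵥ y)‖ ≤ opNorm A * (∑ i, ‖x i‖ ^ 2 + ∑ i, ‖y i‖ ^ 2) := by
  have h1 : star x ⬝ᵥ (A *ᵥ y) = inner ℂ (WithLp.toLp 2 x) (Matrix.toEuclideanLin A (WithLp.toLp 2 y)) := by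
    rw [EuclideanSpace.inner_eq_star_dotProduct, dotProduct_comm]
    rfl
  have h2 := norm_inner_le_norm (𝕜 := ℂ) (WithLp.toLp 2 x) (Matrix.toEuclideanLin A (WithLp.toLp 2 y))
  have h3 : ‖Matrix.toEuclideanLin A (WithLp.toLp 2 y)‖ ≤ opNorm A * ‖WithLp.toLp 2 y‖ :=
    (LinearMap.toContinuousLinearMap (Matrix.toEuclideanLin A)).le_opNorm _
  have h4 := EuclideanSpace.norm_sq_eq (WithLp.toLp 2 x)
  have h5 := EuclideanSpace.norm_sq_eq (WithLp.toLp 2 y)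
  simp only at h4 h5
  rw [h1, ← h4, ← h5]
  have h6 := mul_le_mul_of_nonneg_left h3 (norm_nonneg (WithLp.toLp 2 x))
  nlinarith [mul_nonneg (opNorm_nonneg' A) (sq_nonneg (‖WithLp.toLp 2 x‖ - ‖WithLp.toLp 2 y‖))]

lemma sum_block {n N : ℕ} (blk : Fin n → Fin N) (α : Fin N) {M : Type*} [AddCommMonoid M]
    (g : Fin n → M) :
    ∑ i, (if blk i = α then g i else 0) = ∑ k : {i : Fin n // blk i = α}, g k := by
  rw [← Finset.sum_filter]
  exact Finset.sum_subtype _ (by simp) g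

section main
variable {n N : ℕ} (blk : Fin n → Fin N) (X : Matrix (Fin n) (Fin n) ℂ)

/-- block of X -/
def blockOf (α β : Fin N) : Matrix {i : Fin n // blk i = α} {i : Fin n // blk i = β} ℂ :=
  X.submatrix (fun i => (i : Fin n)) (fun i => (i : Fin n))

/-- diagonal remainder -/
noncomputable def diagPart (c : ℝ) (α : Fin N) : Matrix (Fin n) (Fin n) ℂ :=
  fun i j => if blk i = α then (if blk j = α then X i j - (if i = j then (c : ℂ) else 0) else 0) else 0

/-- pair part -/
noncomputable def pairPart (c : ℝ) (α β : Fin N) : Matrix (Fin n) (Fin n) ℂ :=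
  fun i j => (if blk i = α then (if blk j = β then X i j else 0) else 0)
    + (if blk i = β then (if blk j = α then X i j else 0) else 0)
    + (if blk i = α then (if i = j then (c : ℂ) else 0) else 0)
    + (if blk i = β then (if i = j then (c : ℂ) else 0) else 0)

lemma diagPart_posSemidef (hX : X.IsHermitian) (c : ℝ) (α : Fin N)
    (h : (blockOf blk X α α - (c : ℂ) • 1).PosSemidef) : (diagPart blk X c α).PosSemidef := by
  refine .of_dotProduct_mulVec_nonneg ?_ fun x => ?_
  · ext i j
    have := hX.apply i j
    simp only [conjTranspose_apply, diagPart]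
    by_cases hij : i = j
    · subst hij
      simp only [if_true]
      split_ifs
      · simp only [star_sub, this]; simp
      · simp
    · have hji : ¬ j = i := fun h => hij h.symm
      simp only [hij, hji, if_false, sub_zero]
      split_ifs
      · exact this
      all_goals simp
  · have h2 := h.dotProduct_mulVec_nonneg (fun k => x k)
    convert h2 using 1
    simp only [dotProduct, mulVec, diagPart, ite_mul, zero_mul, Finset.sum_const_zero, mul_ite, mul_zero, blockOf, Pi.star_apply, Matrix.sub_apply, submatrix_apply, Matrix.smul_apply, Matrix.one_apply, Subtype.ext_iff]
    rw [← sum_block blk α (fun i => star (x i) * ∑ j : {i : Fin n // blk i = α}, (X i j - (c : ℂ) • if i = (j : Fin n) then 1 else 0) * x j)]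
    · refine Finset.sum_congr rfl fun i _ => ?_
      split_ifs with hi
      · congr 1
        rw [← sum_block blk α (fun j => (X i j - (c : ℂ) • if i = (j : Fin n) then 1 else 0) * x j)]
        simp
      · simp

lemma pairPart_posSemidef (hX : X.IsHermitian) (α β : Fin N) :
    (pairPart blk X (opNorm (blockOf blk X α β)) α β).PosSemidef := by
  set c := opNorm (blockOf blk X α β)
  refine .of_dotProduct_mulVec_nonneg ?_ fun x => ?_
  · ext i j
    have := hX.apply i j
    simp only [conjTranspose_apply, pairPart, star_add]
    by_cases hij : i = j
    · subst hij
      split_ifs <;> simp_all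
    · have hji : ¬ j = i := fun h => hij h.symm
      simp only [hij, hji, if_false, ite_self, star_zero, add_zero]
      split_ifs <;> simp_all
  · have key := opNorm_bilin (blockOf blk X α β) (fun k => x k) (fun k => x k)
    set q := star (fun k : {i : Fin n // blk i = α} => x k) ⬝ᵥ (blockOf blk X α β *ᵥ fun k => x k) with hq
    have e1 : q = ∑ i, ∑ j, star (x i) * (if blk i = α then (if blk j = β then X i j else 0) else 0) * x j := by
      rw [hq]
      simp only [dotProduct, mulVec, blockOf, submatrix_apply, Pi.star_apply]
      rw [← sum_block blk α (fun i => star (x i) * ∑ j : {i : Fin n // blk i = β}, X i j * x j)]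
      refine Finset.sum_congr rfl fun i _ => ?_
      split_ifs with hi
      · rw [← sum_block blk β (fun j => X i j * x j), Finset.mul_sum]
        refine Finset.sum_congr rfl fun j _ => ?_
        split_ifs <;> simp [mul_assoc]
      · simp
    have e2 : star q = ∑ i, ∑ j, star (x i) * (if blk i = β then (if blk j = α then X i j else 0) else 0) * x j := by
      rw [e1, Finset.sum_comm, star_sum]
      refine Finset.sum_congr rfl fun i _ => ?_
      rw [star_sum]
      refine Finset.sum_congr rfl fun j _ => ?_
      have := hX.apply i j
      split_ifs
      · simp only [star_mul, star_star, ← this]; ring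
      all_goals simp
    have e3 : ∀ γ : Fin N, ((c * ∑ k : {i : Fin n // blk i = γ}, ‖x k‖ ^ 2 : ℝ) : ℂ) =
        ∑ i, ∑ j, star (x i) * (if blk i = γ then (if i = j then (c : ℂ) else 0) else 0) * x j := by
      intro γ
      rw [← sum_block blk γ (fun i => ‖x i‖ ^ 2), Finset.mul_sum]
      push_cast
      refine Finset.sum_congr rfl fun i _ => ?_
      split_ifs with hi
      · simp only [mul_ite, mul_zero, ite_mul, zero_mul, Finset.sum_ite_eq, Finset.mem_univ, if_true]
        have := Complex.conj_mul' (x i)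
        rw [RCLike.star_def]
        push_cast
        linear_combination -(c : ℂ) * this
      · simp
    have e4 : star x ⬝ᵥ (pairPart blk X c α β *ᵥ x) =
        ((2 * q.re + c * ∑ k : {i : Fin n // blk i = α}, ‖x k‖ ^ 2
          + c * ∑ k : {i : Fin n // blk i = β}, ‖x k‖ ^ 2 : ℝ) : ℂ) := by
      rw [Complex.ofReal_add, Complex.ofReal_add, e3, e3]
      have : ((2 * q.re : ℝ) : ℂ) = q + star q := by
        rw [RCLike.star_def, Complex.add_conj]
      rw [this, e2, e1]
      simp only [← Finset.sum_add_distrib, dotProduct, mulVec, Finset.mul_sum, pairPart, Pi.star_apply]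
      refine Finset.sum_congr rfl fun i _ => Finset.sum_congr rfl fun j _ => ?_
      ring
    rw [e4]
    rw [Complex.zero_le_real]
    have := (abs_le.mp (Complex.abs_re_le_norm q)).1
    change 2 * ‖q‖ ≤ c * _ at key
    nlinarith

end main

theorem block_diagonally_dominant_blockCoh_two
    (n N : ℕ) (blk : Fin n → Fin N) (hblk : Function.Surjective blk)
    (X : Matrix (Fin n) (Fin n) ℂ) (hX : X.PosSemidef)
    (hdom : ∀ α : Fin N,
      ∑ β ∈ Finset.univ.erase α,
        opNorm (X.submatrix (fun i : {i : Fin n // blk i = α} => (i : Fin n))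
          (fun i : {i : Fin n // blk i = β} => (i : Fin n)))
      ≤ ⨅ i, (hX.isHermitian.submatrix
          (fun i : {i : Fin n // blk i = α} => (i : Fin n))).eigenvalues i) :
    BlockCohLE blk 2 X := by
  set c : Fin N → Fin N → ℝ := fun α β => opNorm (blockOf blk X α β) with hc
  have hsymm : ∀ α β, c α β = c β α := by
    intro α β
    have : blockOf blk X β α = (blockOf blk X α β)ᴴ := by
      ext i j
      simp [blockOf, hX.isHermitian.apply]
    simp only [hc]
    rw [this, opNorm_conjT]
  have hdecomp : X = ∑ α, diagPart blk X (∑ β ∈ Finset.univ.erase α, c α β) α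
      + ∑ α, ∑ β ∈ Finset.univ.erase α, (1 / 2 : ℂ) • pairPart blk X (c α β) α β := by
    ext i j
    have hD : (∑ α, diagPart blk X (∑ β ∈ Finset.univ.erase α, c α β) α) i j =
        (if blk i = blk j then X i j else 0) -
          (if i = j then ((∑ β ∈ Finset.univ.erase (blk i), c (blk i) β : ℝ) : ℂ) else 0) := by
      rw [Matrix.sum_apply]
      simp only [diagPart, Finset.sum_ite_eq, Finset.mem_univ, if_true]
      by_cases h : i = j
      · subst h; simp
      · by_cases h' : blk i = blk j
        · simp [h, h']
        · simp [h, h', Ne.symm h']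
    have hP : (∑ α, ∑ β ∈ Finset.univ.erase α, (1 / 2 : ℂ) • pairPart blk X (c α β) α β) i j =
        (if blk i = blk j then 0 else X i j) +
          (if i = j then ((∑ β ∈ Finset.univ.erase (blk i), c (blk i) β : ℝ) : ℂ) else 0) := by
      have h1 : ∑ α, ∑ β ∈ Finset.univ.erase α, (if blk i = α then (if blk j = β then X i j else 0) else 0) = if blk i = blk j then 0 else X i j := by
        have : ∀ α, ∑ β ∈ Finset.univ.erase α, (if blk i = α then (if blk j = β then X i j else 0) else 0) = if blk i = α then (if blk j = α then 0 else X i j) else 0 := by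
          intro α
          split_ifs <;> simp_all
        simp only [this, Finset.sum_ite_eq, Finset.mem_univ, if_true]
        simp only [eq_comm]
      have hsw : ∀ f : Fin N → Fin N → ℂ, ∑ α, ∑ β ∈ Finset.univ.erase α, f α β = ∑ α, ∑ β ∈ Finset.univ.erase α, f β α := by
        intro f
        exact Finset.sum_comm' (by simp [eq_comm])
      have h2 : ∑ α, ∑ β ∈ Finset.univ.erase α, (if blk i = β then (if blk j = α then X i j else 0) else 0) = if blk i = blk j then 0 else X i j := by
        rw [hsw, h1]
      have h3 : ∑ α, ∑ β ∈ Finset.univ.erase α, (if blk i = α then (if i = j then (c α β : ℂ) else 0) else 0) = if i = j then ((∑ β ∈ Finset.univ.erase (blk i), c (blk i) β : ℝ) : ℂ) else 0 := by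
        have : ∀ α, ∑ β ∈ Finset.univ.erase α, (if blk i = α then (if i = j then (c α β : ℂ) else 0) else 0) = if blk i = α then (if i = j then ((∑ β ∈ Finset.univ.erase α, c α β : ℝ) : ℂ) else 0) else 0 := by
          intro α
          split_ifs <;> simp
        simp only [this, Finset.sum_ite_eq, Finset.mem_univ, if_true]
      have h4 : ∑ α, ∑ β ∈ Finset.univ.erase α, (if blk i = β then (if i = j then (c α β : ℂ) else 0) else 0) = if i = j then ((∑ β ∈ Finset.univ.erase (blk i), c (blk i) β : ℝ) : ℂ) else 0 := by
        rw [hsw, ← h3]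
        simp only [hsymm]
      simp only [Matrix.sum_apply, Matrix.smul_apply, pairPart, smul_eq_mul, ← Finset.mul_sum, Finset.sum_add_distrib]
      rw [h1, h2, h3, h4]
      ring
    rw [Matrix.add_apply, hD, hP]
    split_ifs <;> ring
  rw [hdecomp]
  refine blockCoh_add _ _ (blockCoh_sum _ _ _ _ fun α _ => ?_)
    (blockCoh_sum _ _ _ _ fun α _ => blockCoh_sum _ _ _ _ fun β _ => ?_)
  · refine blockCoh_of_posSemidef _ _ (diagPart_posSemidef blk X hX.isHermitian _ α
      (sub_smul_one_posSemidef (hX.isHermitian.submatrix _) _ fun i => (hdom α).trans ?_)) {α}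
      (by simp) fun i hi => ?_
    · exact ciInf_le (Set.finite_range _).bddBelow i
    · simp only [Finset.mem_singleton] at hi
      simp [diagPart, hi]
  · refine blockCoh_of_posSemidef _ _ ((pairPart_posSemidef blk X hX.isHermitian α β).smul
      (by positivity)) {α, β} Finset.card_le_two fun i hi => ?_
    simp only [Finset.mem_insert, Finset.mem_singleton, not_or] at hi
    simp [pairPart, hi.1, hi.2]
end

section
/- Fix a partition of {1,…,n} into N nonempty blocks and fix k ≥ 1. The set of Hermitian positive semidefinite matrices X ∈ ℂ^{n×n} with block coherence number at most k (i.e., expressible as a finite sum Σ_j v_j v_j† with each v_j supported on the union of at most k blocks) is a closed subset of ℂ^{n×n}. -/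
open Matrix BigOperators

open scoped ComplexOrder MatrixOrder

/-- Admissible sets of blocks. -/
abbrev BCIdx (N k : ℕ) := {S : Finset (Fin N) // S.card ≤ k}

theorem bc_diag {n : ℕ} (A : Matrix (Fin n) (Fin n) ℂ) (i : Fin n) :
    (A * Aᴴ) i i = ((∑ j, ‖A i j‖ ^ 2 : ℝ) : ℂ) := by
  rw [Matrix.mul_apply]
  push_cast
  refine Finset.sum_congr rfl fun j _ => ?_
  rw [Matrix.conjTranspose_apply]
  exact Complex.mul_conj' _

theorem bc_factor {n N : ℕ} (blk : Fin n → Fin N) (S : Finset (Fin N))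
    {ι : Type*} (s : Finset ι) (v : ι → Fin n → ℂ)
    (hv : ∀ j ∈ s, ∀ i, v j i ≠ 0 → blk i ∈ S) :
    ∃ A : Matrix (Fin n) (Fin n) ℂ,
      (∑ j ∈ s, Matrix.vecMulVec (v j) (star (v j))) = A * Aᴴ ∧
      ∀ i l, blk i ∉ S → A i l = 0 := by
  have hp : (∑ j ∈ s, Matrix.vecMulVec (v j) (star (v j))).PosSemidef :=
    Matrix.posSemidef_sum _ fun j _ => Matrix.posSemidef_vecMulVec_self_star (v j)
  obtain ⟨B, hB⟩ := CStarAlgebra.nonneg_iff_eq_star_mul_self.mp hp.nonneg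
  have hB' : (∑ j ∈ s, Matrix.vecMulVec (v j) (star (v j))) = Bᴴ * Bᴴᴴ := by
    rw [hB, Matrix.conjTranspose_conjTranspose, Matrix.star_eq_conjTranspose]
  refine ⟨Bᴴ, hB', fun i l hi => ?_⟩
  have h0 : (Bᴴ * Bᴴᴴ) i i = 0 := by
    rw [← hB', Matrix.sum_apply]
    refine Finset.sum_eq_zero fun j hj => ?_
    have : v j i = 0 := by
      by_contra h
      exact hi (hv j hj i h)
    simp [Matrix.vecMulVec_apply, this]
  rw [bc_diag] at h0
  have h1 : (∑ j, ‖Bᴴ i j‖ ^ 2 : ℝ) = 0 := by exact_mod_cast h0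
  have h2 := (Finset.sum_eq_zero_iff_of_nonneg (fun j _ => by positivity)).1 h1 l
    (Finset.mem_univ l)
  simpa using h2

theorem bc_iff {n N : ℕ} (blk : Fin n → Fin N) (k : ℕ) (X : Matrix (Fin n) (Fin n) ℂ) :
    BlockCohLE blk k X ↔ ∃ A : BCIdx N k → Fin n → Fin n → ℂ,
      (∀ S i l, blk i ∉ S.1 → A S i l = 0) ∧
      X = ∑ S, Matrix.of (A S) * (Matrix.of (A S))ᴴ := by
  classical
  constructor
  · rintro ⟨m, v, hX, hv⟩
    choose S hS hSv using hv
    let T : Fin m → BCIdx N k := fun j => ⟨S j, hS j⟩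
    have key := fun Q : BCIdx N k => bc_factor blk Q.1 (Finset.univ.filter fun j => T j = Q) v
      (by
        intro j hj i hi
        have : T j = Q := by simpa using hj
        rw [← this]
        exact hSv j i hi)
    choose A hA hA0 using key
    refine ⟨A, hA0, ?_⟩
    rw [hX, ← Finset.sum_fiberwise Finset.univ T]
    exact Finset.sum_congr rfl fun Q _ => hA Q
  · rintro ⟨A, hA, hX⟩
    let e := (Fintype.equivFin (BCIdx N k × Fin n)).symm
    refine ⟨_, fun j i => A (e j).1 i (e j).2, ?_, fun j => ⟨(e j).1.1, (e j).1.2, fun i hi => ?_⟩⟩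
    · rw [e.sum_comp (fun p : BCIdx N k × Fin n =>
        Matrix.vecMulVec (fun i => A p.1 i p.2) (star (fun i => A p.1 i p.2))), hX,
        Fintype.sum_prod_type]
      refine Finset.sum_congr rfl fun S _ => ?_
      ext a b
      simp [Matrix.mul_apply, Matrix.sum_apply, Matrix.vecMulVec_apply]
    · by_contra h
      exact hi (hA _ _ _ h)

/-- The set of (Hermitian positive semidefinite) matrices with block
coherence number at most `k` is closed.  This gives the lower semicontinuity of the block
coherence number used in the limiting argument `X + εI → X`. -/
theorem blockCohLE_isClosed
    (n N k : ℕ) (blk : Fin n → Fin N) (hblk : Function.Surjective blk) (hk : 1 ≤ k) :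
    IsClosed {X : Matrix (Fin n) (Fin n) ℂ | BlockCohLE blk k X} := by
  have : FirstCountableTopology (Matrix (Fin n) (Fin n) ℂ) :=
    inferInstanceAs (FirstCountableTopology (Fin n → Fin n → ℂ))
  have : SequentialSpace (Matrix (Fin n) (Fin n) ℂ) := inferInstance
  apply IsSeqClosed.isClosed
  intro x X hx hlim
  have hx' := fun m => (bc_iff blk k (x m)).1 (hx m)
  choose A hA0 hA using hx'
  have htr : Filter.Tendsto (fun m => ‖(x m).trace‖) Filter.atTop (nhds ‖X.trace‖) :=
    ((continuous_id.matrix_trace).norm.tendsto X).comp hlim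
  obtain ⟨C, hC⟩ := htr.bddAbove_range
  have hC' : ∀ m, ‖(x m).trace‖ ≤ C := fun m => hC ⟨m, rfl⟩
  have htrace : ∀ m, (x m).trace = ((∑ S, ∑ i, ∑ l, ‖A m S i l‖ ^ 2 : ℝ) : ℂ) := by
    intro m
    rw [hA m, Matrix.trace_sum, Complex.ofReal_sum]
    refine Finset.sum_congr rfl fun S _ => ?_
    rw [Matrix.trace, Complex.ofReal_sum]
    refine Finset.sum_congr rfl fun i _ => ?_
    rw [Matrix.diag_apply, bc_diag]
    rfl
  have hent : ∀ m S i l, ‖A m S i l‖ ^ 2 ≤ C := by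
    intro m S i l
    have h := hC' m
    rw [htrace m, Complex.norm_real] at h
    refine le_trans ?_ ((le_abs_self _).trans h)
    refine le_trans ?_ (Finset.single_le_sum (f := fun S => ∑ i, ∑ l, ‖A m S i l‖ ^ 2)
      (fun _ _ => by positivity) (Finset.mem_univ S))
    refine le_trans ?_ (Finset.single_le_sum (f := fun i => ∑ l, ‖A m S i l‖ ^ 2)
      (fun _ _ => by positivity) (Finset.mem_univ i))
    exact Finset.single_le_sum (f := fun l => ‖A m S i l‖ ^ 2)
      (fun _ _ => by positivity) (Finset.mem_univ l)
  have hball : ∀ m, A m ∈ Metric.closedBall (0 : BCIdx N k → Fin n → Fin n → ℂ) (√C) := by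
    intro m
    rw [mem_closedBall_zero_iff]
    have h0 := Real.sqrt_nonneg C
    refine (pi_norm_le_iff_of_nonneg h0).2 fun S => (pi_norm_le_iff_of_nonneg h0).2 fun i =>
      (pi_norm_le_iff_of_nonneg h0).2 fun l => Real.le_sqrt_of_sq_le (hent m S i l)
  obtain ⟨B, -, φ, hφ, hB⟩ := tendsto_subseq_of_bounded Metric.isBounded_closedBall hball
  refine (bc_iff blk k X).2 ⟨B, fun S i l hi => ?_, ?_⟩
  · have hc : Continuous fun B : BCIdx N k → Fin n → Fin n → ℂ => B S i l := by fun_prop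
    refine tendsto_nhds_unique ((hc.tendsto B).comp hB) ?_
    have : ((fun B : BCIdx N k → Fin n → Fin n → ℂ => B S i l) ∘ A ∘ φ) = fun _ => 0 := by
      funext m
      exact hA0 (φ m) S i l hi
    rw [this]
    exact tendsto_const_nhds
  · have hc : Continuous fun B : BCIdx N k → Fin n → Fin n → ℂ =>
        ∑ S, Matrix.of (B S) * (Matrix.of (B S))ᴴ := by
      refine continuous_finsetSum _ fun S _ => ?_
      have h1 : Continuous fun B : BCIdx N k → Fin n → Fin n → ℂ => Matrix.of (B S) :=
        continuous_apply S
      exact h1.matrix_mul h1.matrix_conjTranspose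
    refine tendsto_nhds_unique (hlim.comp hφ.tendsto_atTop) ?_
    have h2 := (hc.tendsto B).comp hB
    refine h2.congr fun m => ?_
    exact (hA (φ m)).symm
end

section
/- Let N ≥ 2 and 2 ≤ k ≤ N, and let Δ, χ ≥ 0 be real numbers, not both zero. If the matrix C = Δ·I_N + χ·J_N has coherence number at most k, then Δ − (√((N−1)/(k−1)) − 1)·χ ≥ 0. -/
open Matrix BigOperators

/-- Cauchy-Schwarz for a vector with at most `k` nonzero entries. -/
theorem sparse_cs {N k : ℕ} (v : Fin N → ℂ)
    (h : (Finset.univ.filter (fun i => v i ≠ 0)).card ≤ k) :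
    ‖∑ i, v i‖ ^ 2 ≤ k * ∑ i, ‖v i‖ ^ 2 := by
  have h1 : ∑ i, v i = ∑ i ∈ Finset.univ.filter (fun i => v i ≠ 0), v i :=
    (Finset.sum_filter_ne_zero _).symm
  have h0 : 0 ≤ ∑ i, ‖v i‖ ^ 2 := Finset.sum_nonneg fun i _ => by positivity
  have h2 : ∑ i ∈ Finset.univ.filter (fun i => v i ≠ 0), ‖v i‖ ^ 2 ≤ ∑ i, ‖v i‖ ^ 2 :=
    Finset.sum_le_sum_of_subset_of_nonneg (Finset.filter_subset _ _)
      fun i _ _ => by positivity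
  have h3 : ((Finset.univ.filter (fun i => v i ≠ 0)).card : ℝ) ≤ k := by exact_mod_cast h
  rw [h1]
  calc _ ≤ (∑ i ∈ Finset.univ.filter (fun i => v i ≠ 0), ‖v i‖) ^ 2 := by
        gcongr
        exact norm_sum_le _ _
    _ ≤ _ := sq_sum_le_card_mul_sum_sq
    _ ≤ _ := mul_le_mul h3 h2 (Finset.sum_nonneg fun i _ => by positivity) (by positivity)

/-- Monogamy relation for the covariance matrix `C = Δ·I + χ·J` of the
GHZ-type distribution: if `C` has coherence number at most `k`, then
`Δ - (√((N-1)/(k-1)) - 1)·χ ≥ 0`. -/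
theorem monogamy_isotropic
    (N k : ℕ) (hN : 2 ≤ N) (hk2 : 2 ≤ k) (hkN : k ≤ N)
    (Δ χ : ℝ) (hΔ : 0 ≤ Δ) (hχ : 0 ≤ χ) (hnz : ¬(Δ = 0 ∧ χ = 0))
    (C : Matrix (Fin N) (Fin N) ℂ)
    (hC : C = (Δ : ℂ) • (1 : Matrix (Fin N) (Fin N) ℂ) +
      (χ : ℂ) • Matrix.of (fun _ _ => (1 : ℂ)))
    (hcoh : CohNumLE k C) :
    0 ≤ Δ - (Real.sqrt (((N : ℝ) - 1) / ((k : ℝ) - 1)) - 1) * χ := by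
  obtain ⟨m, v, hv, hs⟩ := hcoh
  have hent : ∀ a b, C a b = ∑ j, v j a * star (v j b) := by
    intro a b
    rw [hv, Matrix.sum_apply]
    rfl
  have hent' : ∀ a b, C a b = (if a = b then (Δ : ℂ) else 0) + χ := by
    intro a b
    rw [hC]
    simp [Matrix.one_apply]
  have hsum : (N : ℝ) * Δ + N * N * χ = ∑ j, ‖∑ a, v j a‖ ^ 2 := by
    have e1 : ∑ a, ∑ b, C a b = ((N * Δ + N * N * χ : ℝ) : ℂ) := by
      simp [hent', Finset.sum_add_distrib]
      ring
    have e2 : ∑ a, ∑ b, C a b = ((∑ j, ‖∑ a, v j a‖ ^ 2 : ℝ) : ℂ) := by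
      push_cast
      simp_rw [hent, ← Complex.mul_conj', map_sum, Finset.sum_mul_sum]
      conv_rhs => rw [Finset.sum_comm]
      refine Finset.sum_congr rfl fun a _ => ?_
      rw [Finset.sum_comm]
      rfl
    exact_mod_cast e1.symm.trans e2
  have htr : (N : ℝ) * (Δ + χ) = ∑ j, ∑ a, ‖v j a‖ ^ 2 := by
    have e1 : ∑ a, C a a = ((N * (Δ + χ) : ℝ) : ℂ) := by
      simp [hent', mul_add, Finset.sum_add_distrib]
    have e2 : ∑ a, C a a = ((∑ j, ∑ a, ‖v j a‖ ^ 2 : ℝ) : ℂ) := by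
      push_cast
      simp_rw [hent, ← Complex.mul_conj']
      rw [Finset.sum_comm]
      rfl
    exact_mod_cast e1.symm.trans e2
  have hle : (N : ℝ) * Δ + N * N * χ ≤ k * (N * (Δ + χ)) := by
    rw [hsum, htr, Finset.mul_sum]
    exact Finset.sum_le_sum fun j _ => sparse_cs (v j) (hs j)
  have hN' : (2 : ℝ) ≤ N := by exact_mod_cast hN
  have hk' : (2 : ℝ) ≤ k := by exact_mod_cast hk2
  have hkN' : (k : ℝ) ≤ N := by exact_mod_cast hkN
  have hle2 : Δ + N * χ ≤ k * (Δ + χ) := by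
    refine le_of_mul_le_mul_left ?_ (by linarith : (0 : ℝ) < N)
    linarith
  have hk1 : (0 : ℝ) < k - 1 := by linarith
  set r := ((N : ℝ) - 1) / ((k : ℝ) - 1) with hr
  have hrk : r * (k - 1) = N - 1 := div_mul_cancel₀ _ hk1.ne'
  have hr1 : 1 ≤ r := by
    rw [hr, le_div_iff₀ hk1]
    linarith
  have hsq : Real.sqrt r ≤ r := by
    rw [Real.sqrt_le_left (by linarith)]
    nlinarith
  have hmain : (r - 1) * χ ≤ Δ := by
    refine le_of_mul_le_mul_left ?_ hk1
    have : (k - 1) * ((r - 1) * χ) = (N - k) * χ := by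
      linear_combination χ * hrk
    rw [this]
    linarith
  nlinarith
end

section
/- Fix a partition of {1,…,n} into N+1 nonempty blocks B_0, B_1, …, B_N, and let X ∈ ℂ^{n×n} be Hermitian positive semidefinite with tr[X] = 1 and block coherence number at most k (k ≥ 2). Then Σ_{β=1}^{N} ‖X_{0β}‖_tr ≤ √(k−1) · √(tr[X_{00}] · (1 − tr[X_{00}])), where X_{αβ} denotes the submatrix of X with rows in B_α and columns in B_β, and ‖A‖_tr = tr[√(A†A)] is the trace norm. -/
open Matrix BigOperators
open scoped ComplexOrder

/-- The trace norm (sum of singular values) of a complex matrix: the sum of the square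
roots of the eigenvalues of `A†A`. -/
noncomputable def traceNorm {ι κ : Type*} [Fintype ι] [Fintype κ] [DecidableEq κ]
    (A : Matrix ι κ ℂ) : ℝ :=
  ∑ i, Real.sqrt ((Matrix.posSemidef_conjTranspose_mul_self A).1.eigenvalues i)

theorem traceNorm_sum_le {ι κ : Type*} [Fintype ι] [Fintype κ] [DecidableEq κ] {m : ℕ}
    (a : Fin m → ι → ℂ) (b : Fin m → κ → ℂ) (A : Matrix ι κ ℂ)
    (hA : A = ∑ j, Matrix.vecMulVec (a j) (star (b j))) :
    traceNorm A ≤ ∑ j, Real.sqrt (∑ i, ‖a j i‖ ^ 2) * Real.sqrt (∑ i, ‖b j i‖ ^ 2) := by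
  have hP := Matrix.posSemidef_conjTranspose_mul_self A
  set lam := hP.1.eigenvalues with hlam
  have hl0 : ∀ i, 0 ≤ lam i := fun i => hP.eigenvalues_nonneg i
  set U := hP.1.eigenvectorBasis with hU
  have hev : ∀ l, (Aᴴ * A) *ᵥ (U l).ofLp = (lam l : ℂ) • (U l).ofLp := by
    intro l
    have := hP.1.mulVec_eigenvectorBasis l
    rw [this]; ext x; simp [hlam, hU]
  have hin : ∀ i l, star (A *ᵥ (U i).ofLp) ⬝ᵥ (A *ᵥ (U l).ofLp)
      = (lam l : ℂ) * (if i = l then 1 else 0) := by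
    intro i l
    rw [Matrix.star_mulVec, ← Matrix.dotProduct_mulVec, Matrix.mulVec_mulVec, hev,
      dotProduct_smul, smul_eq_mul]
    congr 1
    have := (orthonormal_iff_ite.mp U.orthonormal) i l
    rw [← this, EuclideanSpace.inner_eq_star_dotProduct, dotProduct_comm]
  let s := {i : κ // 0 < lam i}
  let w : s → EuclideanSpace ℂ ι := fun i =>
    WithLp.toLp 2 (((Real.sqrt (lam i.1))⁻¹ : ℂ) • (A *ᵥ (U i.1).ofLp))
  have hw : Orthonormal ℂ w := by
    rw [orthonormal_iff_ite]
    intro i l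
    rw [EuclideanSpace.inner_eq_star_dotProduct, dotProduct_comm]
    simp only [w, star_smul, smul_dotProduct, dotProduct_smul, hin, smul_eq_mul]
    by_cases h : i = l
    · subst h
      have h1 : (Real.sqrt (lam i.1)) ≠ 0 := (Real.sqrt_pos.mpr i.2).ne'
      have h2 : (lam i.1 : ℂ) = (Real.sqrt (lam i.1) : ℂ) * (Real.sqrt (lam i.1) : ℂ) := by
        rw [← Complex.ofReal_mul, Real.mul_self_sqrt (hl0 _)]
      have h3 : (Real.sqrt (lam i.1) : ℂ) ≠ 0 := by exact_mod_cast h1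
      simp only [if_true, mul_one]
      rw [star_inv₀, Complex.star_def, Complex.conj_ofReal]
      rw [h2]
      field_simp
    · have : i.1 ≠ l.1 := fun h' => h (Subtype.ext h')
      simp [h, this]
  have hsig : ∀ i : s, ((Real.sqrt (lam i.1) : ℝ) : ℂ)
      = ∑ j, inner ℂ (w i) (WithLp.toLp 2 (a j)) * inner ℂ (WithLp.toLp 2 (b j)) (U i.1) := by
    intro i
    have e1 : A *ᵥ (U i.1).ofLp
        = ∑ j, (inner ℂ (WithLp.toLp 2 (b j)) (U i.1)) • a j := by
      conv_lhs => rw [hA]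
      rw [Matrix.sum_mulVec]
      refine Finset.sum_congr rfl fun j _ => ?_
      rw [EuclideanSpace.inner_eq_star_dotProduct, Matrix.vecMulVec_mulVec, dotProduct_comm]
      ext x; simp [mul_comm]
    have e2 : inner ℂ (w i) (WithLp.toLp 2 (A *ᵥ (U i.1).ofLp)) = ((Real.sqrt (lam i.1) : ℝ) : ℂ) := by
      rw [EuclideanSpace.inner_eq_star_dotProduct, dotProduct_comm]
      simp only [w, star_smul, smul_dotProduct, hin, smul_eq_mul, if_true, mul_one]
      have h1 : (Real.sqrt (lam i.1)) ≠ 0 := (Real.sqrt_pos.mpr i.2).ne'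
      have h2 : (lam i.1 : ℂ) = (Real.sqrt (lam i.1) : ℂ) * (Real.sqrt (lam i.1) : ℂ) := by
        rw [← Complex.ofReal_mul, Real.mul_self_sqrt (hl0 _)]
      have h3 : (Real.sqrt (lam i.1) : ℂ) ≠ 0 := by exact_mod_cast h1
      rw [star_inv₀, Complex.star_def, Complex.conj_ofReal]
      rw [h2]
      field_simp
    rw [← e2, e1, WithLp.toLp_sum, inner_sum]
    refine Finset.sum_congr rfl fun j _ => ?_
    rw [WithLp.toLp_smul, inner_smul_right, mul_comm]
  have hsum : traceNorm A = ∑ i : s, Real.sqrt (lam i.1) := by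
    unfold traceNorm
    rw [← Finset.sum_subtype (Finset.univ.filter fun i => 0 < lam i) (by simp)
      (fun i => Real.sqrt (lam i))]
    symm
    refine Finset.sum_subset (Finset.subset_univ _) fun i _ hi => ?_
    simp only [Finset.mem_filter, Finset.mem_univ, true_and, not_lt] at hi
    exact Real.sqrt_eq_zero_of_nonpos hi
  rw [hsum]
  calc ∑ i : s, Real.sqrt (lam i.1)
      ≤ ∑ i : s, ∑ j, ‖inner ℂ (w i) (WithLp.toLp 2 (a j))‖ *
          ‖inner ℂ (WithLp.toLp 2 (b j)) (U i.1)‖ := by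
        refine Finset.sum_le_sum fun i _ => ?_
        have h := congrArg norm (hsig i)
        rw [Complex.norm_real, Real.norm_of_nonneg (Real.sqrt_nonneg _)] at h
        rw [h]
        refine (norm_sum_le _ _).trans (le_of_eq ?_)
        simp only [norm_mul]
    _ = ∑ j, ∑ i : s, ‖inner ℂ (w i) (WithLp.toLp 2 (a j))‖ *
          ‖inner ℂ (WithLp.toLp 2 (b j)) (U i.1)‖ := Finset.sum_comm
    _ ≤ _ := by
        refine Finset.sum_le_sum fun j _ => ?_
        refine (Real.sum_mul_le_sqrt_mul_sqrt _ _ _).trans ?_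
        have hU' : Orthonormal ℂ (fun i : s => U i.1) :=
          U.orthonormal.comp _ Subtype.val_injective
        have b1 := hw.sum_inner_products_le (WithLp.toLp 2 (a j)) (s := Finset.univ)
        have b2 := hU'.sum_inner_products_le (WithLp.toLp 2 (b j)) (s := Finset.univ)
        rw [EuclideanSpace.norm_sq_eq] at b1 b2
        simp only [norm_inner_symm (WithLp.toLp 2 (b j))]
        gcongr

/-- Monogamy of block coherence: for a trace-one Hermitian positive
semidefinite matrix `X` with block coherence number at most `k` (`k ≥ 2`), with blocks
labelled `0, 1, …, N`, one has
`∑_{β=1}^{N} ‖X_{0β}‖_tr ≤ √(k-1) · √(tr[X₀₀](1 - tr[X₀₀]))`. -/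
theorem block_coherence_monogamy
    (n N k : ℕ) (hk : 2 ≤ k)
    (blk : Fin n → Fin (N + 1)) (hblk : Function.Surjective blk)
    (X : Matrix (Fin n) (Fin n) ℂ) (hX : X.PosSemidef) (htr : X.trace = 1)
    (hcoh : BlockCohLE blk k X) :
    ∑ β ∈ Finset.univ.erase (0 : Fin (N + 1)),
      traceNorm (X.submatrix (fun i : {i : Fin n // blk i = 0} => (i : Fin n))
        (fun i : {i : Fin n // blk i = β} => (i : Fin n)))
    ≤ Real.sqrt ((k : ℝ) - 1) *
      Real.sqrt ((X.submatrix (fun i : {i : Fin n // blk i = 0} => (i : Fin n))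
          (fun i : {i : Fin n // blk i = 0} => (i : Fin n))).trace.re *
        (1 - (X.submatrix (fun i : {i : Fin n // blk i = 0} => (i : Fin n))
          (fun i : {i : Fin n // blk i = 0} => (i : Fin n))).trace.re)) := by
  classical
  obtain ⟨m, v, hv, hS⟩ := hcoh
  choose S hSc hSm using hS
  -- squared norms of the block components
  let q : Fin m → Fin (N + 1) → ℝ := fun j β => ∑ i : {i : Fin n // blk i = β}, ‖v j i‖ ^ 2
  have hq0 : ∀ j β, 0 ≤ q j β := fun j β => Finset.sum_nonneg fun i _ => by positivity
  have hdiag : ∀ i, X i i = ((∑ j, ‖v j i‖ ^ 2 : ℝ) : ℂ) := by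
    intro i
    rw [hv, Matrix.sum_apply]
    push_cast
    refine Finset.sum_congr rfl fun j _ => ?_
    simp only [Matrix.vecMulVec_apply, Pi.star_apply]
    exact Complex.mul_conj' _
  have hT : (X.submatrix (fun i : {i : Fin n // blk i = 0} => (i : Fin n))
          (fun i : {i : Fin n // blk i = 0} => (i : Fin n))).trace.re = ∑ j, q j 0 := by
    simp only [Matrix.trace, Matrix.diag, Matrix.submatrix_apply, hdiag, q]
    rw [← Complex.ofReal_sum, Complex.ofReal_re, Finset.sum_comm]
  have hall : ∑ j, ∑ β, q j β = 1 := by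
    have h1 : (∑ i, ∑ j, ‖v j i‖ ^ 2 : ℝ) = 1 := by
      have := htr
      simp only [Matrix.trace, Matrix.diag, hdiag] at this
      exact_mod_cast this
    rw [Finset.sum_comm] at h1
    rw [← h1]
    refine Finset.sum_congr rfl fun j _ => ?_
    exact Fintype.sum_fiberwise blk (fun i => ‖v j i‖ ^ 2)
  have hR : 1 - ∑ j, q j 0 = ∑ j, ∑ β ∈ Finset.univ.erase (0 : Fin (N + 1)), q j β := by
    rw [← hall, ← Finset.sum_sub_distrib]
    refine Finset.sum_congr rfl fun j _ => ?_
    rw [← Finset.add_sum_erase _ _ (Finset.mem_univ (0 : Fin (N + 1)))]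
    ring
  rw [hT, hR]
  have hk1 : (0 : ℝ) ≤ (k : ℝ) - 1 := by
    have : (2 : ℝ) ≤ k := by exact_mod_cast hk
    linarith
  have hqS : ∀ j β, β ∉ S j → q j β = 0 := by
    intro j β hβ
    refine Finset.sum_eq_zero fun i _ => ?_
    have : v j i = 0 := by
      by_contra h
      exact hβ (i.2 ▸ hSm j i h)
    simp [this]
  have hrow : ∀ j, Real.sqrt (q j 0) * ∑ β ∈ Finset.univ.erase (0 : Fin (N + 1)),
      Real.sqrt (q j β) ≤ Real.sqrt ((k : ℝ) - 1) * (Real.sqrt (q j 0) *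
        Real.sqrt (∑ β ∈ Finset.univ.erase (0 : Fin (N + 1)), q j β)) := by
    intro j
    by_cases h0 : (0 : Fin (N + 1)) ∈ S j
    · have hsub : (S j).erase 0 ⊆ Finset.univ.erase (0 : Fin (N + 1)) :=
        Finset.erase_subset_erase _ (Finset.subset_univ _)
      have hzero : ∀ β ∈ Finset.univ.erase (0 : Fin (N + 1)), β ∉ (S j).erase 0 → q j β = 0 := by
        intro β hβ hβ'
        refine hqS j β fun h => hβ' (Finset.mem_erase.mpr ⟨(Finset.mem_erase.mp hβ).1, h⟩)
      rw [← Finset.sum_subset hsub (fun β hβ hβ' => hzero β hβ hβ'),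
        ← Finset.sum_subset hsub (f := fun β => Real.sqrt (q j β))
          (fun β hβ hβ' => by simp [hzero β hβ hβ'])]
      have hc : (((S j).erase 0).card : ℝ) ≤ (k : ℝ) - 1 := by
        have h1 := Finset.card_erase_add_one h0
        have h2 : ((S j).erase 0).card + 1 ≤ k := h1 ▸ hSc j
        have h3 : (((S j).erase 0).card : ℝ) + 1 ≤ k := by exact_mod_cast h2
        linarith
      have hcs := Real.sum_mul_le_sqrt_mul_sqrt ((S j).erase 0) (fun _ => (1 : ℝ))
        (fun β => Real.sqrt (q j β))
      simp only [one_mul, one_pow, Finset.sum_const, nsmul_eq_mul, mul_one,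
        Real.sq_sqrt (hq0 j _)] at hcs
      have h4 := hcs.trans (mul_le_mul_of_nonneg_right (Real.sqrt_le_sqrt hc)
        (Real.sqrt_nonneg _))
      have h5 := mul_le_mul_of_nonneg_left h4 (Real.sqrt_nonneg (q j 0))
      refine h5.trans (le_of_eq (by ring))
    · simp [hqS j 0 h0]
  have hblock : ∀ β, traceNorm (X.submatrix (fun i : {i : Fin n // blk i = 0} => (i : Fin n))
        (fun i : {i : Fin n // blk i = β} => (i : Fin n)))
      ≤ ∑ j, Real.sqrt (q j 0) * Real.sqrt (q j β) := by
    intro β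
    refine traceNorm_sum_le (fun j (i : {i : Fin n // blk i = 0}) => v j i)
      (fun j (i : {i : Fin n // blk i = β}) => v j i) _ ?_
    ext x y
    simp [hv, Matrix.sum_apply, Matrix.vecMulVec_apply]
  calc _ ≤ ∑ β ∈ Finset.univ.erase (0 : Fin (N + 1)),
        ∑ j, Real.sqrt (q j 0) * Real.sqrt (q j β) := Finset.sum_le_sum fun β _ => hblock β
    _ = ∑ j, Real.sqrt (q j 0) * ∑ β ∈ Finset.univ.erase (0 : Fin (N + 1)),
          Real.sqrt (q j β) := by
        rw [Finset.sum_comm]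
        simp only [Finset.mul_sum]
    _ ≤ ∑ j, Real.sqrt ((k : ℝ) - 1) * (Real.sqrt (q j 0) *
        Real.sqrt (∑ β ∈ Finset.univ.erase (0 : Fin (N + 1)), q j β)) :=
        Finset.sum_le_sum fun j _ => hrow j
    _ = Real.sqrt ((k : ℝ) - 1) * ∑ j, (Real.sqrt (q j 0) *
        Real.sqrt (∑ β ∈ Finset.univ.erase (0 : Fin (N + 1)), q j β)) := by
        rw [Finset.mul_sum]
    _ ≤ _ := by
        refine mul_le_mul_of_nonneg_left ?_ (Real.sqrt_nonneg _)
        rw [Real.sqrt_mul (Finset.sum_nonneg fun j _ => hq0 j 0)]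
        exact Real.sum_sqrt_mul_sqrt_le _ (fun j => hq0 j 0)
          (fun j => Finset.sum_nonneg fun β _ => hq0 j β)
end

section
/- Let N ≥ 2, 1 ≤ k ≤ N, and let C ∈ ℂ^{N×N} be positive semidefinite. If C − ((N−k)/(N−1))·Λ(C) is positive semidefinite, where Λ(C) denotes the diagonal part of C (the diagonal matrix with entries C_{ii}), then C has coherence number at most k. -/
open Matrix BigOperators
open scoped ComplexOrder

lemma CohNumLE.of_fintype {N k : ℕ} {ι : Type} [Fintype ι] {X : Matrix (Fin N) (Fin N) ℂ}
    (v : ι → Fin N → ℂ)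
    (hX : ∀ a b, X a b = ∑ j, v j a * star (v j b))
    (hv : ∀ j, (Finset.univ.filter (fun i => v j i ≠ 0)).card ≤ k) : CohNumLE k X := by
  refine ⟨Fintype.card ι, fun j => v ((Fintype.equivFin ι).symm j), ?_, fun j => hv _⟩
  ext a b
  rw [hX, Matrix.sum_apply]
  simp only [Matrix.vecMulVec_apply, Pi.star_apply]
  exact (Equiv.sum_comp (Fintype.equivFin ι).symm (fun j => v j a * star (v j b))).symm

lemma psd_factor {N : ℕ} {D : Matrix (Fin N) (Fin N) ℂ} (h : D.PosSemidef) :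
    ∃ B : Matrix (Fin N) (Fin N) ℂ, ∀ a b, D a b = ∑ r, star (B r a) * B r b := by
  obtain ⟨B, hB⟩ : ∃ B : Matrix (Fin N) (Fin N) ℂ, D = Bᴴ * B := by
    open scoped MatrixOrder Matrix.Norms.L2Operator in
    exact CStarAlgebra.nonneg_iff_eq_star_mul_self.mp h.nonneg
  refine ⟨B, fun a b => ?_⟩
  rw [hB, Matrix.mul_apply]
  simp [Matrix.conjTranspose_apply]

lemma count_subsets {N k : ℕ} (t : Finset (Fin N)) (ht : t.card ≤ k) :
    (Finset.univ.filter (fun S : Finset (Fin N) => S.card = k ∧ t ⊆ S)).card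
      = (N - t.card).choose (k - t.card) := by
  have := Finset.card_filter_powersetCard_subset t Finset.univ k (Finset.subset_univ _) ht
  rw [Finset.card_univ, Fintype.card_fin] at this
  rw [← this]
  congr 1
  ext S
  simp

/-- The `k`-subset averaging construction. -/
lemma average_cohNum {N k : ℕ} {D C : Matrix (Fin N) (Fin N) ℂ} (hD : D.PosSemidef)
    (c : ℝ) (hc : 0 ≤ c)
    (hCD : ∀ a b, C a b = (c : ℂ) *
      ((Finset.univ.filter (fun S : Finset (Fin N) => S.card = k ∧ {a, b} ⊆ S)).card : ℂ) * D a b) :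
    CohNumLE k C := by
  obtain ⟨B, hB⟩ := psd_factor hD
  have hs : ((Real.sqrt c : ℝ) : ℂ) * ((Real.sqrt c : ℝ) : ℂ) = (c : ℂ) := by
    rw [← Complex.ofReal_mul, Real.mul_self_sqrt hc]
  refine CohNumLE.of_fintype (ι := Finset (Fin N) × Fin N)
    (fun p i => if p.1.card = k ∧ i ∈ p.1 then ((Real.sqrt c : ℝ) : ℂ) * star (B p.2 i) else 0)
    ?_ ?_
  · intro a b
    rw [hCD, Fintype.sum_prod_type]
    have key : ∀ S : Finset (Fin N), (∑ r, (if S.card = k ∧ a ∈ S then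
        ((Real.sqrt c : ℝ) : ℂ) * star (B r a) else 0) * star (if S.card = k ∧ b ∈ S then
        ((Real.sqrt c : ℝ) : ℂ) * star (B r b) else 0))
        = if S.card = k ∧ {a, b} ⊆ S then (c : ℂ) * D a b else 0 := by
      intro S
      by_cases h1 : S.card = k <;> by_cases h2 : a ∈ S <;> by_cases h3 : b ∈ S <;>
        simp [h1, h2, h3, Finset.insert_subset_iff]
      rw [hB, Finset.mul_sum]
      refine Finset.sum_congr rfl fun r _ => ?_
      rw [← hs]
      simp only [RCLike.star_def]
      ring
    rw [Finset.sum_congr rfl (fun S _ => key S), ← Finset.sum_filter, Finset.sum_const,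
      nsmul_eq_mul]
    ring
  · rintro ⟨S, r⟩
    by_cases h1 : S.card = k
    · refine le_trans (Finset.card_le_card ?_) h1.le
      intro i
      simp only [Finset.mem_filter]
      rintro ⟨-, h⟩
      by_contra h2
      simp [h2] at h
    · simp [h1]

lemma diag_cohNum {N : ℕ} {C : Matrix (Fin N) (Fin N) ℂ} (hC : C.PosSemidef)
    (hd : ∀ a b, a ≠ b → C a b = 0) : CohNumLE 1 C := by
  refine average_cohNum hC 1 zero_le_one ?_
  intro a b
  by_cases h : a = b
  · subst h
    rw [count_subsets _ (by simp)]
    simp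
  · simp [hd a b h]

/-- If `C` is positive semidefinite and `C - ((N-k)/(N-1))·Λ(C)` is
positive semidefinite, where `Λ(C)` is the diagonal part of `C`, then `C` has coherence
number at most `k`. -/
theorem diagonal_dominance_cohNum
    (N k : ℕ) (hN : 2 ≤ N) (hk1 : 1 ≤ k) (hkN : k ≤ N)
    (C : Matrix (Fin N) (Fin N) ℂ) (hC : C.PosSemidef)
    (h : (C - (((N : ℂ) - k) / ((N : ℂ) - 1)) •
      Matrix.diagonal (fun i => C i i)).PosSemidef) :
    CohNumLE k C := by
  obtain ⟨n, rfl⟩ : ∃ n, N = n + 2 := ⟨N - 2, by omega⟩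
  have hn : ((n : ℂ) + 1) ≠ 0 := by exact_mod_cast Nat.succ_ne_zero n
  have hn' : (((n + 2 : ℕ) : ℂ) - 1) = (n : ℂ) + 1 := by push_cast; ring
  rw [hn'] at h
  rcases Nat.lt_or_ge k 2 with hk | hk
  · obtain rfl : k = 1 := by omega
    apply diag_cohNum hC
    intro a b hab
    obtain ⟨B, hB⟩ := psd_factor h
    have h0 : ∀ r, B r a = 0 := by
      have h1 := hB a a
      have h2 : ((n + 2 : ℕ) : ℂ) - ((1 : ℕ) : ℂ) = (n : ℂ) + 1 := by push_cast; ring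
      rw [h2, div_self hn] at h1
      simp only [one_smul, Matrix.sub_apply, Matrix.diagonal_apply_eq, sub_self] at h1
      have h3 := (Finset.sum_eq_zero_iff_of_nonneg
        (fun r _ => star_mul_self_nonneg (B r a))).mp h1.symm
      intro r
      simpa using h3 r (Finset.mem_univ _)
    have h1 := hB a b
    simpa [h0, hab] using h1
  · obtain ⟨m, rfl⟩ : ∃ m, k = m + 2 := ⟨k - 2, by omega⟩
    have hpos : 0 < n.choose m := Nat.choose_pos (by omega)
    have hb : (n.choose m : ℂ) ≠ 0 := by exact_mod_cast hpos.ne'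
    refine average_cohNum h ((n.choose m : ℝ)⁻¹) (by positivity) ?_
    intro a b
    push_cast
    by_cases hab : a = b
    · subst hab
      rw [count_subsets _ (by simp)]
      have hch : ((n + 1 : ℕ) : ℂ) * (n.choose m : ℂ)
          = ((n + 1).choose (m + 1) : ℂ) * ((m + 1 : ℕ) : ℂ) := by
        exact_mod_cast Nat.add_one_mul_choose_eq n m
      push_cast at hch
      have e1 : n + 2 - ({a, a} : Finset (Fin (n + 2))).card = n + 1 := by simp
      have e2 : m + 2 - ({a, a} : Finset (Fin (n + 2))).card = m + 1 := by simp
      rw [e1, e2]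
      simp only [Matrix.sub_apply, Matrix.smul_apply, Matrix.diagonal_apply_eq, smul_eq_mul]
      field_simp
      linear_combination (C a a) * hch
    · rw [count_subsets _ (by rw [Finset.card_pair hab]; omega), Finset.card_pair hab]
      simp [hab, hb]
end

section
/- Let N ≥ 2 and let C ∈ ℂ^{N×N} be a nonzero positive semidefinite matrix satisfying tr[C²] / (tr[C])² ≤ 1/(N−1). Then C has coherence number at most 2. -/
open Matrix BigOperators
open scoped ComplexOrder

theorem quad_cons {n : ℕ} (M : Fin (n+1) → Fin (n+1) → ℝ) (hs : ∀ i j, M i j = M j i)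
    (t : ℝ) (z : Fin n → ℝ) :
    ∑ i, ∑ j, M i j * (Fin.cons t z : Fin (n+1) → ℝ) i * (Fin.cons t z : Fin (n+1) → ℝ) j
      = M 0 0 * t ^ 2 + 2 * t * ∑ i : Fin n, M 0 i.succ * z i
        + ∑ i : Fin n, ∑ j : Fin n, M i.succ j.succ * z i * z j := by
  simp only [Fin.sum_univ_succ, Fin.cons_zero, Fin.cons_succ, Finset.sum_add_distrib,
    Finset.mul_sum]
  have : ∀ i : Fin n, M i.succ 0 * z i * t = t * (M 0 i.succ * z i) := by
    intro i; rw [hs i.succ 0]; ring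
  have h2 : ∀ i : Fin n, M 0 i.succ * t * z i = t * (M 0 i.succ * z i) := by
    intro i; ring
  simp only [this, h2, mul_assoc, ← Finset.mul_sum]
  ring

theorem zmat : ∀ (n : ℕ) (M : Fin n → Fin n → ℝ), (∀ i j, M i j = M j i) →
    (∀ i j, i ≠ j → M i j ≤ 0) → (∀ y : Fin n → ℝ, 0 ≤ ∑ i, ∑ j, M i j * y i * y j) →
    ∃ x : Fin n → ℝ, (∀ i, 0 < x i) ∧ ∀ i, 0 ≤ ∑ j, M i j * x j := by
  intro n
  induction n with
  | zero => intro M _ _ _; exact ⟨fun _ => 1, fun i => i.elim0, fun i => i.elim0⟩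
  | succ n ih =>
    intro M hs hz hq
    have hq' : ∀ t (z : Fin n → ℝ), 0 ≤ M 0 0 * t ^ 2 + 2 * t * ∑ i : Fin n, M 0 i.succ * z i
        + ∑ i : Fin n, ∑ j : Fin n, M i.succ j.succ * z i * z j := by
      intro t z; rw [← quad_cons M hs]; exact hq _
    have hb : ∀ i : Fin n, M 0 i.succ ≤ 0 := fun i => hz _ _ (Fin.succ_ne_zero i).symm
    have h00 : 0 ≤ M 0 0 := by simpa using hq' 1 0
    by_cases hB : ∀ i : Fin n, M 0 i.succ = 0
    · obtain ⟨x, hx, hMx⟩ := ih (fun i j => M i.succ j.succ) (fun i j => hs _ _)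
        (fun i j hij => hz _ _ (by simpa using hij)) (fun y => by simpa using hq' 0 y)
      refine ⟨Fin.cons 1 x, fun i => ?_, fun i => ?_⟩
      · refine Fin.cases ?_ (fun i => ?_) i <;> simp [hx]
      · refine Fin.cases ?_ (fun i => ?_) i
        · simpa [Fin.sum_univ_succ, hB] using h00
        · simpa [Fin.sum_univ_succ, hs i.succ 0, hB] using hMx i
    · push Not at hB
      obtain ⟨k, hk⟩ := hB
      have hk' : M 0 k.succ < 0 := lt_of_le_of_ne (hb k) hk
      have hpos : 0 < M 0 0 := by
        rcases h00.lt_or_eq with h | h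
        · exact h
        · exfalso
          have := hq' ((|M k.succ k.succ| + 1) / (-M 0 k.succ)) (Pi.single k 1)
          simp only [Pi.single_apply, mul_ite, mul_one, mul_zero, ite_mul, zero_mul,
            Finset.sum_ite_eq', Finset.sum_ite_eq, Finset.mem_univ, if_true, ← h] at this
          have h3 : 2 * ((|M k.succ k.succ| + 1) / (-M 0 k.succ)) * M 0 k.succ
              = -2 * (|M k.succ k.succ| + 1) := by
            field_simp
          have := le_abs_self (M k.succ k.succ)
          have := abs_nonneg (M k.succ k.succ)
          simp only [zero_mul, zero_add] at *
          linarith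
      obtain ⟨x, hx, hMx⟩ := ih
        (fun i j => M i.succ j.succ - M 0 i.succ * M 0 j.succ / M 0 0)
        (fun i j => by rw [hs i.succ j.succ]; ring)
        (fun i j hij => by
          have h1 := hz i.succ j.succ (by simpa using hij)
          have h2 : 0 ≤ M 0 i.succ * M 0 j.succ / M 0 0 :=
            div_nonneg (mul_nonneg_of_nonpos_of_nonpos (hb i) (hb j)) h00
          linarith)
        (fun y => by
          have h1 := hq' (-(∑ i : Fin n, M 0 i.succ * y i) / M 0 0) y
          have h2 : ∑ i : Fin n, ∑ j : Fin n,
              (M i.succ j.succ - M 0 i.succ * M 0 j.succ / M 0 0) * y i * y j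
              = ∑ i : Fin n, ∑ j : Fin n, M i.succ j.succ * y i * y j
                - (∑ i : Fin n, M 0 i.succ * y i) * (∑ i : Fin n, M 0 i.succ * y i) / M 0 0 := by
            rw [Finset.sum_mul_sum, Finset.sum_div, ← Finset.sum_sub_distrib]
            refine Finset.sum_congr rfl fun i _ => ?_
            rw [Finset.sum_div, ← Finset.sum_sub_distrib]
            refine Finset.sum_congr rfl fun j _ => ?_
            ring
          rw [h2]
          refine h1.trans_eq ?_
          field_simp
          ring)
      have hsum : ∑ i : Fin n, M 0 i.succ * x i < 0 := by
        apply Finset.sum_neg' 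
        · intro i _; exact mul_nonpos_of_nonpos_of_nonneg (hb i) (hx i).le
        · exact ⟨k, Finset.mem_univ _, mul_neg_of_neg_of_pos hk' (hx k)⟩
      refine ⟨Fin.cons (-(∑ i : Fin n, M 0 i.succ * x i) / M 0 0) x, fun i => ?_, fun i => ?_⟩
      · refine Fin.cases ?_ (fun i => ?_) i
        · simp only [Fin.cons_zero]
          exact div_pos (by linarith) hpos
        · simpa using hx i
      · refine Fin.cases ?_ (fun i => ?_) i
        · simp only [Fin.sum_univ_succ, Fin.cons_zero, Fin.cons_succ]
          apply le_of_eq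
          field_simp
          ring
        · simp only [Fin.sum_univ_succ, Fin.cons_zero, Fin.cons_succ]
          refine (hMx i).trans_eq ?_
          simp only [sub_mul, Finset.sum_sub_distrib]
          rw [hs i.succ 0, neg_div, mul_neg, Finset.sum_div, Finset.mul_sum]
          have : ∑ j : Fin n, M 0 i.succ * M 0 j.succ / M 0 0 * x j
              = ∑ j : Fin n, M 0 i.succ * (M 0 j.succ * x j / M 0 0) :=
            Finset.sum_congr rfl fun j _ => by ring
          rw [this]; ring

theorem quad_nonneg {n : ℕ} (hn : 2 ≤ n) (M : Fin n → Fin n → ℝ)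
    (htr : 0 ≤ ∑ i, M i i)
    (h : (∑ i, ∑ j, M i j ^ 2) * ((n : ℝ) - 1) ≤ (∑ i, M i i) ^ 2) (y : Fin n → ℝ) :
    0 ≤ ∑ i, ∑ j, M i j * y i * y j := by
  by_contra hneg
  push Not at hneg
  set q := ∑ i, ∑ j, M i j * y i * y j with hq
  set s := ∑ i, y i ^ 2 with hs
  have hs0 : 0 ≤ s := Finset.sum_nonneg fun i _ => sq_nonneg _
  set P : Fin n → Fin n → ℝ := fun i j => (if i = j then s else 0) - y i * y j with hP
  have hcs := Finset.sum_mul_sq_le_sq_mul_sq (Finset.univ : Finset (Fin n × Fin n))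
    (fun p => M p.1 p.2) (fun p => P p.1 p.2)
  simp only [Fintype.sum_prod_type] at hcs
  have h1 : ∑ i, ∑ j, M i j * P i j = s * ∑ i, M i i - q := by
    simp only [hP, mul_sub, Finset.sum_sub_distrib, mul_ite, mul_zero, Finset.sum_ite_eq,
      Finset.mem_univ, if_true, hq, Finset.mul_sum]
    congr 1
    · exact Finset.sum_congr rfl fun i _ => by ring
    · exact Finset.sum_congr rfl fun i _ => Finset.sum_congr rfl fun j _ => by ring
  have h2 : ∑ i, ∑ j, P i j ^ 2 = s ^ 2 * ((n : ℝ) - 1) := by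
    have e : ∀ i j, P i j ^ 2 = (if i = j then s ^ 2 - 2 * s * y i ^ 2 else 0)
        + y i ^ 2 * y j ^ 2 := by
      intro i j
      simp only [hP]
      split_ifs with hij
      · subst hij; ring
      · ring
    simp only [e, Finset.sum_add_distrib, Finset.sum_ite_eq, Finset.mem_univ, if_true,
      Finset.sum_sub_distrib, ← Finset.mul_sum, ← Finset.sum_mul, ← hs]
    simp
    ring
  rw [h1, h2] at hcs
  have h3 : (∑ i, ∑ j, M i j ^ 2) * (s ^ 2 * ((n : ℝ) - 1)) ≤ (s * ∑ i, M i i) ^ 2 := by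
    nlinarith [mul_le_mul_of_nonneg_left h (sq_nonneg s)]
  have h4 : 0 ≤ s * ∑ i, M i i := mul_nonneg hs0 htr
  nlinarith

theorem coh_zero {N k : ℕ} : CohNumLE k (0 : Matrix (Fin N) (Fin N) ℂ) :=
  ⟨0, fun i => i.elim0, by simp, fun i => i.elim0⟩

theorem coh_add {N k : ℕ} {A B : Matrix (Fin N) (Fin N) ℂ} (hA : CohNumLE k A)
    (hB : CohNumLE k B) : CohNumLE k (A + B) := by
  obtain ⟨m, v, rfl, hv⟩ := hA
  obtain ⟨l, w, rfl, hw⟩ := hB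
  refine ⟨m + l, Fin.append v w, ?_, ?_⟩
  · simp [Fin.sum_univ_add]
  · intro j
    refine Fin.addCases (fun i => ?_) (fun i => ?_) j
    · simpa using hv i
    · simpa using hw i

theorem coh_sum {N k : ℕ} {ι : Type*} (s : Finset ι) (A : ι → Matrix (Fin N) (Fin N) ℂ)
    (h : ∀ i ∈ s, CohNumLE k (A i)) : CohNumLE k (∑ i ∈ s, A i) :=
  Finset.sum_induction A (CohNumLE k) (fun _ _ => coh_add) coh_zero h

theorem coh_two {N : ℕ} (i j : Fin N) (a b : ℂ) :
    CohNumLE 2 (vecMulVec (Pi.single i a + Pi.single j b : Fin N → ℂ)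
      (star (Pi.single i a + Pi.single j b : Fin N → ℂ))) := by
  refine ⟨1, fun _ => Pi.single i a + Pi.single j b, by simp, fun _ => ?_⟩
  refine (Finset.card_le_card (t := {i, j}) ?_).trans Finset.card_le_two
  intro p hp
  simp only [Finset.mem_filter, Finset.mem_univ, true_and, Pi.add_apply, Pi.single_apply] at hp
  simp only [Finset.mem_insert, Finset.mem_singleton]
  by_contra hcon
  push Not at hcon
  simp [hcon.1, hcon.2] at hp

theorem coh_diag {N : ℕ} (i : Fin N) (r : ℝ) (hr : 0 ≤ r) :
    CohNumLE 2 (Matrix.single i i (r : ℂ)) := by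
  have := coh_two i i ((√r : ℝ) : ℂ) 0
  convert this using 1
  ext p q
  have : ((√r : ℝ) : ℂ) * (√r : ℝ) = r := by exact_mod_cast Real.mul_self_sqrt hr
  simp only [Matrix.single_apply, vecMulVec_apply, Pi.star_apply, Pi.add_apply, Pi.single_apply]
  by_cases hp : p = i <;> by_cases hq : q = i <;> simp [hp, hq, this, Ne.symm, eq_comm (a := i)]

theorem coh_pair {N : ℕ} (i j : Fin N) (hij : i ≠ j) (a b : ℝ) (ha : 0 ≤ a) (hb : 0 ≤ b)
    (c : ℂ) (hc : a * b = ‖c‖ ^ 2) :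
    CohNumLE 2 (Matrix.single i i (a : ℂ) + Matrix.single j j (b : ℂ) + Matrix.single i j c
      + Matrix.single j i (star c)) := by
  obtain ⟨u, hu, hcu⟩ : ∃ u : ℂ, u * star u = 1 ∧ c = ‖c‖ * u := by
    by_cases h0 : c = 0
    · exact ⟨1, by simp, by simp [h0]⟩
    · have hn : (‖c‖ : ℂ) ≠ 0 := by simpa using h0
      refine ⟨c / ‖c‖, ?_, by field_simp⟩
      have := Complex.mul_conj' c
      simp only [star_div₀, Complex.star_def, Complex.conj_ofReal]
      field_simp
      exact this
  have hA : ((√a : ℝ) : ℂ) * (√a : ℝ) = a := by exact_mod_cast Real.mul_self_sqrt ha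
  have hB : ((√b : ℝ) : ℂ) * (√b : ℝ) = b := by exact_mod_cast Real.mul_self_sqrt hb
  have hAB : ((√a : ℝ) : ℂ) * (√b : ℝ) = ‖c‖ := by
    rw [← Complex.ofReal_mul, ← Real.sqrt_mul ha, hc, Real.sqrt_sq (norm_nonneg c)]
  have := coh_two i j ((√a : ℝ) : ℂ) ((√b : ℝ) * star u)
  convert this using 1
  have hst : star c = ‖c‖ * star u := by
    conv_lhs => rw [hcu]
    simp
  rw [hst]
  nth_rewrite 1 [hcu]
  rw [← hAB, ← hA, ← hB]
  ext p q
  simp only [Matrix.add_apply, Matrix.single_apply, vecMulVec_apply, Pi.star_apply, Pi.add_apply,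
    Pi.single_apply]
  have hji := hij.symm
  simp only [Complex.star_def] at hu ⊢
  by_cases hp : p = i
  · subst hp
    by_cases hq : q = p
    · subst hq; simp [hij, hji]
    · by_cases hq' : q = j
      · subst hq'; simp [hij, hji]; ring
      · simp [hij, hji, hq, hq', Ne.symm hq, Ne.symm hq']
  · by_cases hp' : p = j
    · subst hp'
      by_cases hq : q = i
      · subst hq; simp [hij, hji]; ring
      · by_cases hq' : q = p
        · subst hq'; simp [hij, hji]; linear_combination (-(√b:ℂ)*(√b:ℂ)) * hu
        · simp [hij, hji, hq, hq', Ne.symm hq, Ne.symm hq']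
    · simp [hp, hp', Ne.symm hp, Ne.symm hp']

theorem coh_of_scaled {N : ℕ} (C : Matrix (Fin N) (Fin N) ℂ) (hC : C.IsHermitian)
    (x : Fin N → ℝ) (hx : ∀ i, 0 < x i)
    (h : ∀ i, ∑ j, (if i = j then 0 else ‖C i j‖ * x j) ≤ (C i i).re * x i) :
    CohNumLE 2 C := by
  let a : Fin N → Fin N → ℝ := fun i j => if i = j then 0 else ‖C i j‖ * x j / x i / 2
  have hsym : ∀ i j, star (C i j) = C j i := fun i j => hC.apply j i
  have hnorm : ∀ i j, ‖C j i‖ = ‖C i j‖ := fun i j => by rw [← hsym i j, norm_star]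
  have hdec : C = ∑ i, Matrix.single i i (((C i i).re - 2 * ∑ j, a i j : ℝ) : ℂ)
      + ∑ i, ∑ j, (if i = j then 0 else
        (Matrix.single i i (a i j : ℂ) + Matrix.single j j (a j i : ℂ)
          + Matrix.single i j (C i j / 2) + Matrix.single j i (star (C i j / 2)))) := by
    have e : ∀ i j, (if i = j then (0 : Matrix (Fin N) (Fin N) ℂ) else
        (Matrix.single i i (a i j : ℂ) + Matrix.single j j (a j i : ℂ)
          + Matrix.single i j (C i j / 2) + Matrix.single j i (star (C i j / 2))))
        = Matrix.single i i (a i j : ℂ) + Matrix.single j j (a j i : ℂ)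
          + Matrix.single i j (if i = j then 0 else C i j / 2)
          + Matrix.single j i (if i = j then 0 else C j i / 2) := by
      intro i j
      split_ifs with hij
      · subst hij; simp [a]
      · simp [← hsym i j]
    simp only [e, Finset.sum_add_distrib]
    rw [Finset.sum_comm (f := fun i j => Matrix.single j j (a j i : ℂ))]
    ext p q
    simp only [Matrix.add_apply, Matrix.sum_apply, Matrix.single_apply, ite_and,
      Finset.sum_ite_eq', Finset.sum_ite_eq, Finset.mem_univ, if_true]
    by_cases hpq : p = q
    · subst hpq
      have hre : ((C p p).re : ℂ) = C p p := by
        have := hsym p p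
        exact Complex.conj_eq_iff_re.mp this
      simp [hre]
      ring
    · simp [hpq, Ne.symm hpq]
  rw [hdec]
  refine coh_add (coh_sum _ _ fun i _ => coh_diag _ _ ?_)
    (coh_sum _ _ fun i _ => coh_sum _ _ fun j _ => ?_)
  · have h1 : 2 * ∑ j, a i j = (∑ j, (if i = j then 0 else ‖C i j‖ * x j)) / x i := by
      rw [Finset.mul_sum, Finset.sum_div]
      refine Finset.sum_congr rfl fun j _ => ?_
      simp only [a]; split_ifs
      · simp
      · ring
    rw [h1, sub_nonneg, div_le_iff₀ (hx i)]
    exact h i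
  · split_ifs with hij
    · exact coh_zero
    · have hxi := hx i
      have hxj := hx j
      refine coh_pair i j hij _ _ ?_ ?_ _ ?_
      · simp only [a, if_neg hij]; positivity
      · simp only [a, if_neg (Ne.symm hij)]; positivity
      · simp only [a, if_neg hij, if_neg (Ne.symm hij), hnorm i j, norm_div]
        norm_num
        field_simp
        try norm_num

theorem purity_cohNum_two
    (N : ℕ) (hN : 2 ≤ N)
    (C : Matrix (Fin N) (Fin N) ℂ) (hC : C.PosSemidef) (hC0 : C ≠ 0)
    (h : Matrix.trace (C * C) / (Matrix.trace C) ^ 2 ≤ 1 / ((N : ℂ) - 1)) :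
    CohNumLE 2 C := by
  have hsym : ∀ i j, star (C i j) = C j i := fun i j => hC.1.apply j i
  have hnorm : ∀ i j, ‖C j i‖ = ‖C i j‖ := fun i j => by rw [← hsym i j, norm_star]
  have hre : ∀ p, ((C p p).re : ℂ) = C p p := fun p => Complex.conj_eq_iff_re.mp (hsym p p)
  have hd : ∀ p, 0 ≤ (C p p).re := fun p => by
    have := hC.diag_nonneg (i := p)
    rw [← hre p] at this
    exact_mod_cast this
  have ht : Matrix.trace C = ((∑ i, (C i i).re : ℝ) : ℂ) := by
    simp [Matrix.trace, hre]
  have ht2 : Matrix.trace (C * C) = ((∑ i, ∑ j, ‖C i j‖ ^ 2 : ℝ) : ℂ) := by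
    simp only [Matrix.trace, Matrix.diag_apply, Matrix.mul_apply, Complex.ofReal_sum]
    refine Finset.sum_congr rfl fun i _ => Finset.sum_congr rfl fun j _ => ?_
    rw [← hsym i j]
    have := Complex.mul_conj' (C i j)
    simpa using this
  have hne : Matrix.trace C ≠ 0 := fun h0 => hC0 (hC.trace_eq_zero_iff.mp h0)
  have hT0 : 0 ≤ ∑ i, (C i i).re := Finset.sum_nonneg fun i _ => hd i
  have hT : 0 < ∑ i, (C i i).re := by
    refine lt_of_le_of_ne hT0 fun h0 => hne ?_
    rw [ht, ← h0]; simp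
  have hN1 : (0 : ℝ) < (N : ℝ) - 1 := by
    have : (2 : ℝ) ≤ N := by exact_mod_cast hN
    linarith
  have hreal : (∑ i, ∑ j, ‖C i j‖ ^ 2) / (∑ i, (C i i).re) ^ 2 ≤ 1 / ((N : ℝ) - 1) := by
    rw [ht, ht2] at h
    exact_mod_cast h
  rw [div_le_div_iff₀ (by positivity) hN1, one_mul] at hreal
  let M : Fin N → Fin N → ℝ := fun i j => if i = j then (C i i).re else -‖C i j‖
  have hM2 : ∀ i j, M i j ^ 2 = ‖C i j‖ ^ 2 := by
    intro i j
    simp only [M]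
    split_ifs with hij
    · subst hij
      conv_rhs => rw [← hre i]
      simp
    · ring
  obtain ⟨x, hx, hMx⟩ := zmat N M
    (fun i j => by
      by_cases hij : i = j
      · subst hij; rfl
      · simp [M, hij, Ne.symm hij, hnorm i j])
    (fun i j hij => by simp [M, hij])
    (quad_nonneg hN M (by simpa [M] using hT0) (by
      simp only [hM2]
      simpa [M] using hreal))
  refine coh_of_scaled C hC.1 x hx fun i => ?_
  have h1 := hMx i
  have h2 : ∑ j, M i j * x j = (C i i).re * x i
      - ∑ j, (if i = j then 0 else ‖C i j‖ * x j) := by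
    have : ∀ j, M i j * x j = (if i = j then (C i i).re * x i else 0)
        - (if i = j then 0 else ‖C i j‖ * x j) := by
      intro j
      simp only [M]
      split_ifs with hij
      · subst hij; ring
      · ring
    simp only [this, Finset.sum_sub_distrib, Finset.sum_ite_eq, Finset.mem_univ, if_true]
  linarith
end
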